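/- With F the generic homogeneous polynomial of degree d ≥ n and Φ_d the universal flex polynomial (determined modulo F by R_{F,ℓ} ≡ ℓ^{n!}·Φ_d mod F for all linear forms ℓ), the ideal (F, Φ_d) ⊂ K[c,x] is prime. -/

import Mathlib

/-!
STATEMENT 18: With `F` the generic homogeneous polynomial of degree `d ≥ n` and
`Φ_d` the universal flex polynomial (bihomogeneous of bidegree
`(Σ_{k=1}^n n!/k, d·Σ_{k=1}^n n!/k − (n+1)!)`, determined modulo `F` by
`R_{F,ℓ} ≡ ℓ^{n!}·Φ_d (mod F)` for all linear forms `ℓ`), the ideal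
`(F, Φ_d) ⊂ K[c,x]` is prime.

Setup: `K[c] = A := MvPolynomial (Fin (n+1) →₀ ℕ) K`, `K[c,x] = AX :=
MvPolynomial (Fin (n+1)) A`, `F = Σ_{|a|=d} c_a x^a ∈ AX`; the resultant for degrees
`(1,…,n,1)` is abstract (natural over commutative `K`-algebras, with the vanishing
property over `K`).
-/


open MvPolynomial Polynomial

set_option synthInstance.maxHeartbeats 1000000
set_option maxHeartbeats 1000000

/-- The `k`-th directional Taylor coefficient `f_k(x,y)` of `f`, as a polynomial in
the variables `y` with coefficients in `R[x]`; `f(x + t y) = Σ_k f_k(x,y) t^k / k!`. -/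
noncomputable def dirCoeffY {R : Type} [CommRing R] {n : ℕ}
    (f : MvPolynomial (Fin (n + 1)) R) (k : ℕ) :
    MvPolynomial (Fin (n + 1)) (MvPolynomial (Fin (n + 1)) R) :=
  (k.factorial : MvPolynomial (Fin (n + 1)) (MvPolynomial (Fin (n + 1)) R)) *
    (Polynomial.coeff
      (MvPolynomial.aeval
        (fun i => Polynomial.C (MvPolynomial.C (MvPolynomial.X i)) +
          Polynomial.X * Polynomial.C (MvPolynomial.X i)) f) k)

/-- The generic homogeneous polynomial `F = Σ_{|a|=d} c_a x^a` of degree `d`. -/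
noncomputable def genericPoly (K : Type) [CommRing K] (n d : ℕ) :
    MvPolynomial (Fin (n + 1)) (MvPolynomial (Fin (n + 1) →₀ ℕ) K) :=
  ∑ a ∈ Finset.finsuppAntidiag (Finset.univ : Finset (Fin (n + 1))) d,
    MvPolynomial.monomial a (MvPolynomial.X a)

/-! ### Polynomials without zeros off a coordinate hyperplane -/

theorem MvPolynomial.eq_monomial_single_of_eval_ne_zero {K σ : Type} [Field K] [IsAlgClosed K]
    [Finite σ] (i : σ) (f : MvPolynomial σ K) (h : ∀ x, x i ≠ 0 → MvPolynomial.eval x f ≠ 0) :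
    ∃ (e : ℕ) (a : K), f = MvPolynomial.monomial (Finsupp.single i e) a := by
  have hrad : (MvPolynomial.X i : MvPolynomial σ K) ∈ (Ideal.span {f}).radical := by
    rw [← MvPolynomial.vanishingIdeal_zeroLocus_eq_radical (K := K),
      MvPolynomial.mem_vanishingIdeal_iff]
    intro x hx
    have hf : MvPolynomial.eval x f = 0 := by
      have := MvPolynomial.mem_zeroLocus_iff.1 hx f (Ideal.mem_span_singleton_self f)
      simpa [MvPolynomial.aeval_eq_eval] using this
    by_contra hne
    exact h x (by simpa using hne) hf
  obtain ⟨N, hN⟩ := hrad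
  rw [Ideal.mem_span_singleton] at hN
  obtain ⟨e, -, he⟩ := (dvd_prime_pow (MvPolynomial.X_prime (i := i)) N).1 hN
  obtain ⟨u, hu⟩ := he.symm
  obtain ⟨a, -, ha⟩ := MvPolynomial.isUnit_iff_eq_C_of_isReduced.1 u.isUnit
  refine ⟨e, a, ?_⟩
  rw [← hu, ha, MvPolynomial.X_pow_eq_monomial, mul_comm, MvPolynomial.C_mul_monomial, mul_one]

theorem MvPolynomial.exists_eval_ne_zero {K σ : Type} [Field K] [Infinite K]
    {f : MvPolynomial σ K} (hf : f ≠ 0) : ∃ x, MvPolynomial.eval x f ≠ 0 := by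
  by_contra! h
  exact hf (MvPolynomial.funext fun x => by simpa using h x)

/-- A family of polynomials whose generic member does not vanish off a coordinate hyperplane
is a single power of that coordinate. -/
theorem MvPolynomial.eq_monomial_single_of_generic {K σ ι : Type} [Field K] [IsAlgClosed K]
    [Finite σ] (i : σ) (f : MvPolynomial σ (MvPolynomial ι K)) (q : MvPolynomial ι K) (hq : q ≠ 0)
    (h : ∀ c x, MvPolynomial.eval c q ≠ 0 → x i ≠ 0 →
      MvPolynomial.eval x (MvPolynomial.map (MvPolynomial.eval c) f) ≠ 0) :
    ∃ (e : ℕ) (p : MvPolynomial ι K), f = MvPolynomial.monomial (Finsupp.single i e) p := by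
  classical
  have : Infinite K := IsAlgClosed.instInfinite
  have key : ∀ c, MvPolynomial.eval c q ≠ 0 → ∃ e : ℕ, ∀ m,
      (MvPolynomial.eval c (f.coeff m) ≠ 0 ↔ m = Finsupp.single i e) := by
    intro c hc
    obtain ⟨e, a, hea⟩ := MvPolynomial.eq_monomial_single_of_eval_ne_zero i _ (fun x => h c x hc)
    have ha : a ≠ 0 := by
      rintro rfl
      exact h c (fun _ => 1) hc one_ne_zero (by simp [hea])
    refine ⟨e, fun m => ?_⟩
    rw [← MvPolynomial.coeff_map, hea, MvPolynomial.coeff_monomial]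
    split_ifs with hm
    · simp [ha, hm]
    · simpa using fun h' => hm h'.symm
  obtain ⟨c₀, hc₀⟩ := MvPolynomial.exists_eval_ne_zero hq
  obtain ⟨e, he⟩ := key c₀ hc₀
  refine ⟨e, f.coeff (Finsupp.single i e), ?_⟩
  ext1 m
  rw [MvPolynomial.coeff_monomial]
  split_ifs with hm
  · rw [hm]
  by_contra hne
  have hne' : f.coeff (Finsupp.single i e) ≠ 0 := by
    intro h0
    exact (he _).2 rfl (by rw [h0, map_zero])
  obtain ⟨c, hc⟩ := MvPolynomial.exists_eval_ne_zero (mul_ne_zero (mul_ne_zero hq hne) hne')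
  simp only [map_mul, mul_ne_zero_iff] at hc
  obtain ⟨e', he'⟩ := key c hc.1.1
  exact hm (((he' _).1 hc.2).trans ((he' _).1 hc.1.2).symm)

theorem MvPolynomial.eval_aeval_polynomial {R ι : Type} [CommRing R] (v : ι → Polynomial R) (t : R)
    (p : MvPolynomial ι R) :
    (MvPolynomial.aeval v p).eval t = MvPolynomial.eval (fun a => (v a).eval t) p := by
  induction p using MvPolynomial.induction_on with
  | C a => simp
  | add p q hp hq => simp [hp, hq]
  | mul_X p i hp => simp [hp]

/-! ### Forms with prescribed coefficients -/

section Forms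

variable {R S : Type} [CommRing R] [CommRing S] {n : ℕ}

/-- The form `∑_{|a| = d} c_a x^a`. -/
noncomputable def formOf (d : ℕ) (c : (Fin (n + 1) →₀ ℕ) → R) : MvPolynomial (Fin (n + 1)) R :=
  ∑ a ∈ Finset.finsuppAntidiag (Finset.univ : Finset (Fin (n + 1))) d,
    MvPolynomial.monomial a (c a)

theorem mem_finsuppAntidiag_univ_iff {d : ℕ} {a : Fin (n + 1) →₀ ℕ} :
    a ∈ Finset.finsuppAntidiag (Finset.univ : Finset (Fin (n + 1))) d ↔ ∑ i, a i = d := by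
  simp [Finset.mem_finsuppAntidiag]

theorem formOf_isHomogeneous (d : ℕ) (c : (Fin (n + 1) →₀ ℕ) → R) :
    (formOf d c).IsHomogeneous d := by
  refine MvPolynomial.IsHomogeneous.sum _ _ _ fun a ha => ?_
  refine MvPolynomial.isHomogeneous_monomial _ ?_
  rw [← mem_finsuppAntidiag_univ_iff.1 ha, Finsupp.degree_eq_sum]

theorem coeff_formOf (d : ℕ) (c : (Fin (n + 1) →₀ ℕ) → R) (a : Fin (n + 1) →₀ ℕ) :
    (formOf d c).coeff a = if ∑ i, a i = d then c a else 0 := by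
  classical
  rw [formOf, MvPolynomial.coeff_sum]
  simp only [MvPolynomial.coeff_monomial, Finset.sum_ite_eq', mem_finsuppAntidiag_univ_iff]

theorem map_formOf (φ : R →+* S) (d : ℕ) (c : (Fin (n + 1) →₀ ℕ) → R) :
    MvPolynomial.map φ (formOf d c) = formOf d fun a => φ (c a) := by
  simp [formOf]

theorem formOf_congr {d : ℕ} {c c' : (Fin (n + 1) →₀ ℕ) → R}
    (h : ∀ a, ∑ i, a i = d → c a = c' a) : formOf d c = formOf d c' :=
  Finset.sum_congr rfl fun a ha => by rw [h a (mem_finsuppAntidiag_univ_iff.1 ha)]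

theorem formOf_coeff {d : ℕ} {f : MvPolynomial (Fin (n + 1)) R} (hf : f.IsHomogeneous d) :
    formOf d (fun a => f.coeff a) = f := by
  ext a
  rw [coeff_formOf]
  split_ifs with h
  · rfl
  · refine (hf.coeff_eq_zero ?_).symm
    rwa [Finsupp.degree_eq_sum]

theorem genericPoly_eq_formOf (K : Type) [CommRing K] (n d : ℕ) :
    genericPoly K n d = formOf d MvPolynomial.X := rfl

/-- The substitution `x ↦ x + x₀ s`. -/
noncomputable def shear (s : Fin (n + 1) → R) :
    MvPolynomial (Fin (n + 1)) R →ₐ[R] MvPolynomial (Fin (n + 1)) R :=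
  MvPolynomial.aeval fun i => MvPolynomial.X i + MvPolynomial.C (s i) * MvPolynomial.X 0

theorem shear_isHomogeneous (s : Fin (n + 1) → R) {d : ℕ} {f : MvPolynomial (Fin (n + 1)) R}
    (hf : f.IsHomogeneous d) : (shear s f).IsHomogeneous d := by
  have h1 : ∀ i, (MvPolynomial.X i + MvPolynomial.C (s i) * MvPolynomial.X 0 :
      MvPolynomial (Fin (n + 1)) R).IsHomogeneous 1 := fun i =>
    (MvPolynomial.isHomogeneous_X R i).add (MvPolynomial.isHomogeneous_C_mul_X (s i) 0)
  simpa [shear] using hf.aeval _ h1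

theorem shear_shear_neg (s : Fin (n + 1) → R) (hs : s 0 = 0) (f : MvPolynomial (Fin (n + 1)) R) :
    shear s (shear (-s) f) = f := by
  have : (shear s).comp (shear (-s)) = AlgHom.id R (MvPolynomial (Fin (n + 1)) R) := by
    ext1 i
    simp [shear, hs]
  simpa using DFunLike.congr_fun this f

theorem map_shear (φ : R →+* S) (s : Fin (n + 1) → R) (f : MvPolynomial (Fin (n + 1)) R) :
    MvPolynomial.map φ (shear s f) = shear (fun i => φ (s i)) (MvPolynomial.map φ f) := by
  induction f using MvPolynomial.induction_on with
  | C a => simp [shear, MvPolynomial.algebraMap_eq]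
  | add p q hp hq => simp [hp, hq]
  | mul_X p i hp => simp [hp]; simp [shear]

theorem eval_shear (s x : Fin (n + 1) → R) (f : MvPolynomial (Fin (n + 1)) R) :
    MvPolynomial.eval x (shear s f) = MvPolynomial.eval (fun i => x i + s i * x 0) f := by
  induction f using MvPolynomial.induction_on with
  | C a => simp [shear, MvPolynomial.algebraMap_eq]
  | add p q hp hq => simp [hp, hq]
  | mul_X p i hp => simp [hp]; simp [shear]

/-- The coefficients of the form with coefficients `c` after the substitution `x ↦ x + x₀ s`. -/
noncomputable def twist (d : ℕ) (s : Fin (n + 1) → R) (c : (Fin (n + 1) →₀ ℕ) → R) :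
    (Fin (n + 1) →₀ ℕ) → R :=
  fun a => if ∑ i, a i = d then (shear s (formOf d c)).coeff a else c a

theorem formOf_twist (d : ℕ) (s : Fin (n + 1) → R) (c : (Fin (n + 1) →₀ ℕ) → R) :
    formOf d (twist d s c) = shear s (formOf d c) := by
  rw [← formOf_coeff (shear_isHomogeneous s (formOf_isHomogeneous d c))]
  exact formOf_congr fun a ha => by rw [twist, if_pos ha]

theorem map_twist (φ : R →+* S) (d : ℕ) (s : Fin (n + 1) → R) (c : (Fin (n + 1) →₀ ℕ) → R)
    (a : Fin (n + 1) →₀ ℕ) :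
    φ (twist d s c a) = twist d (fun i => φ (s i)) (fun a => φ (c a)) a := by
  simp only [twist]
  split_ifs
  · rw [← map_formOf, ← map_shear, MvPolynomial.coeff_map]
  · rfl

theorem twist_twist_neg (d : ℕ) (s : Fin (n + 1) → R) (hs : s 0 = 0)
    (c : (Fin (n + 1) →₀ ℕ) → R) : twist d s (twist d (-s) c) = c := by
  funext a
  by_cases ha : ∑ i, a i = d
  · rw [twist, if_pos ha, formOf_twist, shear_shear_neg s hs, coeff_formOf, if_pos ha]
  · simp only [twist, if_neg ha]

theorem twist_zero (d : ℕ) (c : (Fin (n + 1) →₀ ℕ) → R) : twist d 0 c = c := by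
  have := twist_twist_neg d (0 : Fin (n + 1) → R) rfl c
  funext a
  by_cases ha : ∑ i, a i = d
  · rw [twist, if_pos ha]
    have : shear (0 : Fin (n + 1) → R) = AlgHom.id R _ := by
      ext1 i
      simp [shear]
    simp [this, coeff_formOf, ha]
  · simp only [twist, if_neg ha]

theorem MvPolynomial.IsHomogeneous.coeff_single_eq_eval {σ : Type} [Fintype σ] [DecidableEq σ]
    {d : ℕ} {f : MvPolynomial σ R} (hf : f.IsHomogeneous d) (i : σ) :
    f.coeff (Finsupp.single i d) = MvPolynomial.eval (Pi.single i 1) f := by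
  rw [MvPolynomial.eval_eq]
  have hval : ∀ a ∈ f.support, a ≠ Finsupp.single i d →
      f.coeff a * ∏ j ∈ a.support, (Pi.single i 1 : σ → R) j ^ a j = 0 := by
    intro a ha hne
    have hdeg : a.degree = d := by
      by_contra h
      exact MvPolynomial.mem_support_iff.1 ha (hf.coeff_eq_zero h)
    obtain ⟨j, hji, hj⟩ : ∃ j, j ≠ i ∧ a j ≠ 0 := by
      by_contra! h
      apply hne
      have : a = Finsupp.single i (a i) := by
        ext j
        by_cases hj : j = i
        · subst hj; simp
        · rw [h j hj, Finsupp.single_eq_of_ne hj]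
      rw [this, Finsupp.degree_single] at hdeg
      rw [this, hdeg]
    rw [Finset.prod_eq_zero (Finsupp.mem_support_iff.2 hj), mul_zero]
    rw [Pi.single_eq_of_ne hji, zero_pow hj]
  rw [Finset.sum_eq_single (Finsupp.single i d) hval]
  · rw [Finset.prod_eq_one, mul_one]
    intro j hj
    have : j = i := by
      by_contra h
      simp [Finsupp.single_eq_of_ne h] at hj
    subst this
    simp
  · intro h
    rw [MvPolynomial.notMem_support_iff.1 h, zero_mul]

theorem twist_single_zero (d : ℕ) (s : Fin (n + 1) → R) (hs : s 0 = 0)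
    (c : (Fin (n + 1) →₀ ℕ) → R) :
    twist d s c (Finsupp.single 0 d) =
      MvPolynomial.eval (fun i => if i = 0 then 1 else s i) (formOf d c) := by
  rw [twist, if_pos (by simp),
    (shear_isHomogeneous s (formOf_isHomogeneous d c)).coeff_single_eq_eval, eval_shear]
  congr 1
  congr 1
  funext i
  by_cases hi : i = 0
  · subst hi; simp [hs]
  · simp [hi]

/-- The restriction of `f` to the line through `x` with direction `y`. -/
noncomputable def lineRestrict (x y : Fin (n + 1) → R) :
    MvPolynomial (Fin (n + 1)) R →ₐ[R] Polynomial R :=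
  MvPolynomial.aeval fun i => Polynomial.C (x i) + Polynomial.X * Polynomial.C (y i)

theorem lineRestrict_shear (s x y : Fin (n + 1) → R) (f : MvPolynomial (Fin (n + 1)) R) :
    lineRestrict x y (shear s f) =
      lineRestrict (fun i => x i + s i * x 0) (fun i => y i + s i * y 0) f := by
  have : (lineRestrict x y).comp (shear s) =
      lineRestrict (fun i => x i + s i * x 0) (fun i => y i + s i * y 0) := by
    ext1 i
    simp [lineRestrict, shear]
    ring
  simpa using DFunLike.congr_fun this f

/-- The value at `y` of the form of degree `k` in `n` variables with coefficients
`c_{(d - k, b)}`, `|b| = k`. -/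
def tailForm (d k : ℕ) (c : (Fin (n + 1) →₀ ℕ) → R) (y : Fin n → R) : R :=
  ∑ a ∈ (Finset.finsuppAntidiag (Finset.univ : Finset (Fin (n + 1))) d).filter
    (fun a => a 0 + k = d), c a * ∏ i : Fin n, y i ^ a i.succ

theorem coeff_lineRestrict_formOf (d k : ℕ) (c : (Fin (n + 1) →₀ ℕ) → R) (r : R) (y : Fin n → R) :
    (lineRestrict (Fin.cons r 0) (Fin.cons 0 y) (formOf d c)).coeff k =
      r ^ (d - k) * tailForm d k c y := by
  rw [formOf, map_sum, Polynomial.finsetSum_coeff, tailForm, Finset.sum_filter, Finset.mul_sum]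
  refine Finset.sum_congr rfl fun a ha => ?_
  have ha' := mem_finsuppAntidiag_univ_iff.1 ha
  rw [Fin.sum_univ_succ] at ha'
  have : lineRestrict (Fin.cons r 0) (Fin.cons 0 y) (MvPolynomial.monomial a (c a)) =
      Polynomial.monomial (∑ i : Fin n, a i.succ)
        (r ^ a 0 * (c a * ∏ i : Fin n, y i ^ a i.succ)) := by
    rw [lineRestrict, MvPolynomial.aeval_monomial, Finsupp.prod_fintype _ _ (by simp),
      Fin.prod_univ_succ]
    simp only [Fin.cons_zero, Fin.cons_succ, Pi.zero_apply, Polynomial.C_0, zero_add, mul_zero,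
      add_zero, mul_pow, Finset.prod_mul_distrib, Finset.prod_pow_eq_pow_sum,
      ← Polynomial.C_mul_X_pow_eq_monomial, map_mul, map_pow, map_prod]
    simp only [Polynomial.algebraMap_eq]
    ring
  rw [this, Polynomial.coeff_monomial]
  split_ifs with h1 h2 h2
  · congr 2; omega
  · omega
  · omega
  · simp

end Forms

/-! ### The resultant of `n` forms of degrees `1, …, n` in `n` variables -/

section Degenerate

variable {R S K : Type} [CommRing R] [CommRing S] [Field K] {n : ℕ}

theorem map_tailForm (φ : R →+* S) (d k : ℕ) (c : (Fin (n + 1) →₀ ℕ) → R) (y : Fin n → R) :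
    φ (tailForm d k c y) = tailForm d k (fun a => φ (c a)) (fun i => φ (y i)) := by
  simp [tailForm]

theorem tailForm_congr {d k : ℕ} {c c' : (Fin (n + 1) →₀ ℕ) → R} {y : Fin n → R}
    (h : ∀ a, ∑ i, a i = d → a 0 + k = d → c a = c' a) :
    tailForm d k c y = tailForm d k c' y := by
  refine Finset.sum_congr rfl fun a ha => ?_
  rw [Finset.mem_filter, mem_finsuppAntidiag_univ_iff] at ha
  rw [h a ha.1 ha.2]

theorem tailForm_sub_mul (d k : ℕ) (c c' : (Fin (n + 1) →₀ ℕ) → R) (r r' : R) (y : Fin n → R) :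
    tailForm d k (fun a => r * c a - r' * c' a) y =
      r * tailForm d k c y - r' * tailForm d k c' y := by
  simp only [tailForm, Finset.mul_sum, ← Finset.sum_sub_distrib]
  exact Finset.sum_congr rfl fun a _ => by ring

theorem tailForm_mul (d k : ℕ) (c : (Fin (n + 1) →₀ ℕ) → R) (r : R) (y : Fin n → R) :
    tailForm d k (fun a => r * c a) y = r * tailForm d k c y := by
  simp only [tailForm, Finset.mul_sum]
  exact Finset.sum_congr rfl fun a _ => by ring

theorem tailForm_zero_right {d k : ℕ} (hk : k ≠ 0) (c : (Fin (n + 1) →₀ ℕ) → R) :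
    tailForm d k c 0 = 0 := by
  refine Finset.sum_eq_zero fun a ha => ?_
  rw [Finset.mem_filter, mem_finsuppAntidiag_univ_iff, Fin.sum_univ_succ] at ha
  obtain ⟨i, -, hi⟩ : ∃ i ∈ Finset.univ, a (Fin.succ i) ≠ 0 :=
    Finset.exists_ne_zero_of_sum_ne_zero (f := fun i : Fin n => a i.succ) (by omega)
  rw [Finset.prod_eq_zero (Finset.mem_univ i), mul_zero]
  rw [Pi.zero_apply, zero_pow hi]

/-- Any family of forms `g k` of degree `k` occurs as a family of tail forms. -/
theorem tailForm_coeff {d k : ℕ} (hk : k ≤ d) {g : ℕ → MvPolynomial (Fin n) R}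
    (hg : (g k).IsHomogeneous k) (y : Fin n → R) :
    tailForm d k (fun a => (g (d - a 0)).coeff a.tail) y = MvPolynomial.eval y (g k) := by
  classical
  rw [MvPolynomial.eval_eq', tailForm]
  symm
  refine Finset.sum_of_injOn (fun b => Finsupp.cons (d - k) b) ?_ ?_ ?_ ?_
  · intro b _ b' _ h
    simpa using congrArg Finsupp.tail h
  · intro b hb
    have hdeg : b.degree = k := by
      by_contra h
      exact MvPolynomial.mem_support_iff.1 hb (hg.coeff_eq_zero h)
    rw [Finset.mem_coe, Finset.mem_filter, mem_finsuppAntidiag_univ_iff, Fin.sum_univ_succ]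
    simp only [Finsupp.cons_zero, Finsupp.cons_succ]
    rw [← Finsupp.degree_eq_sum, hdeg]
    omega
  · intro a ha hna
    rw [Finset.mem_filter, mem_finsuppAntidiag_univ_iff] at ha
    have hk' : d - a 0 = k := by omega
    have : (g (d - a 0)).coeff a.tail = 0 := by
      by_contra hne
      refine hna ⟨a.tail, ?_, ?_⟩
      · rw [Finset.mem_coe, MvPolynomial.mem_support_iff, ← hk']
        exact hne
      · have : d - k = a 0 := by omega
        simp only [this, Finsupp.cons_tail]
    rw [this, zero_mul]
  · intro b hb
    have : d - (d - k) = k := by omega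
    simp [this]

/-- The tail forms of degrees `1, …, n` have a common nontrivial zero. -/
def Degenerate (d : ℕ) (c : (Fin (n + 1) →₀ ℕ) → K) : Prop :=
  ∃ y : Fin n → K, y ≠ 0 ∧ ∀ k, 1 ≤ k → k ≤ n → tailForm d k c y = 0

/-- The exponents of the coefficients entering the tail form of degree `k`. -/
def tailIndex (n d k : ℕ) : Set (Fin (n + 1) →₀ ℕ) := {a | ∑ i, a i = d ∧ a 0 + k = d}

open Classical in
/-- Multiplication by `r` of the coefficients with index in `s`. -/
noncomputable def scaleOn (s : Set (Fin (n + 1) →₀ ℕ)) (r : R) (c : (Fin (n + 1) →₀ ℕ) → R) :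
    (Fin (n + 1) →₀ ℕ) → R :=
  fun a => if a ∈ s then r * c a else c a

theorem tailForm_scaleOn_self (d k : ℕ) (r : R) (c : (Fin (n + 1) →₀ ℕ) → R) (y : Fin n → R) :
    tailForm d k (scaleOn (tailIndex n d k) r c) y = r * tailForm d k c y := by
  rw [← tailForm_mul]
  exact tailForm_congr fun a h1 h2 => by rw [scaleOn, if_pos ⟨h1, h2⟩]

theorem tailForm_scaleOn_of_disjoint {d k : ℕ} {s : Set (Fin (n + 1) →₀ ℕ)}
    (h : Disjoint s (tailIndex n d k)) (r : R) (c : (Fin (n + 1) →₀ ℕ) → R) (y : Fin n → R) :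
    tailForm d k (scaleOn s r c) y = tailForm d k c y :=
  tailForm_congr fun _ h1 h2 => by
    rw [scaleOn, if_neg (Set.disjoint_right.1 h (show _ ∈ tailIndex n d k from ⟨h1, h2⟩))]

theorem disjoint_tailIndex {d k k' : ℕ} (h : k ≠ k') :
    Disjoint (tailIndex n d k) (tailIndex n d k') :=
  Set.disjoint_left.2 fun a h1 h2 => h (by have := h1.2; have := h2.2; omega)

theorem degenerate_scaleOn_tailIndex_iff {d k : ℕ} {r : K} (hr : r ≠ 0)
    (c : (Fin (n + 1) →₀ ℕ) → K) :
    Degenerate d (scaleOn (tailIndex n d k) r c) ↔ Degenerate d c := by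
  refine exists_congr fun y => and_congr_right fun _ => forall_congr' fun k' =>
    forall₂_congr fun _ _ => ?_
  by_cases hk : k = k'
  · subst hk
    rw [tailForm_scaleOn_self, mul_eq_zero, or_iff_right hr]
  · rw [tailForm_scaleOn_of_disjoint (disjoint_tailIndex hk)]

theorem degenerate_scaleOn_iff_of_disjoint {d : ℕ} {s : Set (Fin (n + 1) →₀ ℕ)}
    (h : ∀ k, 1 ≤ k → k ≤ n → Disjoint s (tailIndex n d k)) (r : K)
    (c : (Fin (n + 1) →₀ ℕ) → K) :
    Degenerate d (scaleOn s r c) ↔ Degenerate d c := by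
  refine exists_congr fun y => and_congr_right fun _ => forall_congr' fun k' =>
    forall₂_congr fun h1 h2 => ?_
  rw [tailForm_scaleOn_of_disjoint (h k' h1 h2)]

theorem exists_pow_of_scaleOn [IsAlgClosed K] {p : MvPolynomial (Fin (n + 1) →₀ ℕ) K} (hp : p ≠ 0)
    (s : Set (Fin (n + 1) →₀ ℕ))
    (h : ∀ (r : K) c, r ≠ 0 → MvPolynomial.eval c p ≠ 0 →
      MvPolynomial.eval (scaleOn s r c) p ≠ 0) :
    ∃ e : ℕ, ∀ (r : K) c,
      MvPolynomial.eval (scaleOn s r c) p = r ^ e * MvPolynomial.eval c p := by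
  classical
  let f : MvPolynomial Unit (MvPolynomial (Fin (n + 1) →₀ ℕ) K) :=
    MvPolynomial.aeval (fun a => if a ∈ s
      then MvPolynomial.X () * MvPolynomial.C (MvPolynomial.X a)
      else MvPolynomial.C (MvPolynomial.X a)) p
  have hf : ∀ c x, MvPolynomial.eval x (MvPolynomial.map (MvPolynomial.eval c) f) =
      MvPolynomial.eval (scaleOn s (x ()) c) p := by
    intro c x
    have : ((MvPolynomial.eval x).comp (MvPolynomial.map (MvPolynomial.eval c))).comp
        (MvPolynomial.aeval (fun a => if a ∈ s
          then MvPolynomial.X () * MvPolynomial.C (MvPolynomial.X a)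
          else MvPolynomial.C (MvPolynomial.X a) :
            (Fin (n + 1) →₀ ℕ) → MvPolynomial Unit (MvPolynomial (Fin (n + 1) →₀ ℕ) K)) :
          MvPolynomial (Fin (n + 1) →₀ ℕ) K →ₐ[K] _).toRingHom =
        MvPolynomial.eval (scaleOn s (x ()) c) := by
      apply MvPolynomial.ringHom_ext
      · intro r
        simp [MvPolynomial.algebraMap_apply]
      · intro a
        by_cases ha : a ∈ s <;> simp [ha, scaleOn]
    exact DFunLike.congr_fun this p
  obtain ⟨e, q, hq⟩ := MvPolynomial.eq_monomial_single_of_generic () f p hp (by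
    intro c x hc hx
    rw [hf]
    exact h _ _ hx hc)
  refine ⟨e, fun r c => ?_⟩
  have h1 := hf c fun _ => r
  have h2 := hf c fun _ => 1
  have h3 : scaleOn s 1 c = c := by
    funext a
    simp [scaleOn]
  rw [hq] at h1 h2
  simp only [MvPolynomial.map_monomial, MvPolynomial.eval_monomial] at h1 h2
  simp only [h3] at h2
  rw [← h1, ← h2]
  simp [mul_comm]

theorem exists_degree_of_eval_eq_zero_iff_degenerate [IsAlgClosed K] {d : ℕ}
    {p : MvPolynomial (Fin (n + 1) →₀ ℕ) K} (hp : p ≠ 0)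
    (h : ∀ c, MvPolynomial.eval c p = 0 ↔ Degenerate d c) :
    ∃ e : ℕ → ℕ,
      (∀ k, ∀ (r : K) c, MvPolynomial.eval (scaleOn (tailIndex n d k) r c) p =
        r ^ e k * MvPolynomial.eval c p) ∧
      ∀ (r : K) c, MvPolynomial.eval (fun a => r * c a) p =
        r ^ (∑ k ∈ Finset.Icc 1 n, e k) * MvPolynomial.eval c p := by
  have : Infinite K := IsAlgClosed.instInfinite
  have h1 : ∀ k, ∃ e : ℕ, ∀ (r : K) c, MvPolynomial.eval (scaleOn (tailIndex n d k) r c) p =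
      r ^ e * MvPolynomial.eval c p := fun k =>
    exists_pow_of_scaleOn hp _ fun r c hr hc => by
      rwa [Ne, h, degenerate_scaleOn_tailIndex_iff hr, ← h]
  choose e he using h1
  refine ⟨e, he, fun r c => ?_⟩
  let s : ℕ → Set (Fin (n + 1) →₀ ℕ) := fun m => {a | ∃ k ∈ Finset.Icc 1 m, a ∈ tailIndex n d k}
  have hs : ∀ m (r : K) c, MvPolynomial.eval (scaleOn (s m) r c) p =
      r ^ (∑ k ∈ Finset.Icc 1 m, e k) * MvPolynomial.eval c p := by
    intro m r c
    induction m with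
    | zero =>
      have : scaleOn (s 0) r c = c := by
        funext a
        simp [scaleOn, s]
      simp [this]
    | succ m ih =>
      have : scaleOn (s (m + 1)) r c = scaleOn (tailIndex n d (m + 1)) r (scaleOn (s m) r c) := by
        funext a
        by_cases h1 : a ∈ tailIndex n d (m + 1)
        · have h2 : a ∉ s m := by
            rintro ⟨k, hk, hk'⟩
            rw [Finset.mem_Icc] at hk
            exact Set.disjoint_left.1 (disjoint_tailIndex (by omega)) hk' h1
          have h3 : a ∈ s (m + 1) := ⟨m + 1, by simp, h1⟩
          simp [scaleOn, h1, h2, h3]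
        · have h2 : a ∈ s (m + 1) ↔ a ∈ s m := by
            constructor
            · rintro ⟨k, hk, hk'⟩
              rw [Finset.mem_Icc] at hk
              refine ⟨k, Finset.mem_Icc.2 ⟨hk.1, ?_⟩, hk'⟩
              by_contra hlt
              have : k = m + 1 := by omega
              exact h1 (this ▸ hk')
            · rintro ⟨k, hk, hk'⟩
              rw [Finset.mem_Icc] at hk
              exact ⟨k, Finset.mem_Icc.2 ⟨hk.1, by omega⟩, hk'⟩
          by_cases h3 : a ∈ s m
          · simp [scaleOn, h1, h3, h2.2 h3]
          · simp [scaleOn, h1, h3, mt h2.1 h3]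
      rw [this, he, ih, Finset.sum_Icc_succ_top (by omega), pow_add]
      ring
  have hdis : ∀ k, 1 ≤ k → k ≤ n → Disjoint (s n)ᶜ (tailIndex n d k) := by
    intro k h1 h2
    rw [Set.disjoint_left]
    exact fun a ha ha' => ha ⟨k, Finset.mem_Icc.2 ⟨h1, h2⟩, ha'⟩
  obtain ⟨e₀, he₀⟩ := exists_pow_of_scaleOn hp (s n)ᶜ fun r c hr hc => by
    rwa [Ne, h, degenerate_scaleOn_iff_of_disjoint hdis, ← h]
  obtain ⟨c₀, hc₀⟩ := MvPolynomial.exists_eval_ne_zero hp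
  have : e₀ = 0 := by
    by_contra hne
    have h1 : MvPolynomial.eval (scaleOn (s n)ᶜ 0 c₀) p ≠ 0 := by
      rwa [Ne, h, degenerate_scaleOn_iff_of_disjoint hdis, ← h]
    rw [he₀, zero_pow hne, zero_mul] at h1
    exact h1 rfl
  have h4 : (fun a => r * c a) = scaleOn (s n)ᶜ r (scaleOn (s n) r c) := by
    funext a
    by_cases ha : a ∈ s n <;> simp [scaleOn, ha]
  rw [h4, he₀, hs, this, pow_zero, one_mul]

end Degenerate

section LowerBound

variable {K : Type} [Field K] {n : ℕ}

theorem sum_coeff_mul_pow_eq_eval {R : Type} [CommRing R] (y : Fin n → R) (r : R) :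
    Polynomial.eval r (∑ i : Fin n, Polynomial.monomial (i : ℕ) (y i)) =
      ∑ i : Fin n, r ^ (i : ℕ) * y i := by
  simp [Polynomial.eval_finsetSum, mul_comm]

theorem Polynomial.sum_monomial_coeff_of_natDegree_lt {R : Type} [CommRing R] {p : Polynomial R}
    (hp : p.natDegree < n) : ∑ i : Fin n, Polynomial.monomial (i : ℕ) (p.coeff i) = p := by
  rw [Fin.sum_univ_eq_sum_range (fun i => Polynomial.monomial i (p.coeff i))]
  exact (p.as_sum_range' n hp).symm

theorem Polynomial.natDegree_sum_monomial_lt {R : Type} [CommRing R] (hn : 1 ≤ n)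
    (y : Fin n → R) : (∑ i : Fin n, Polynomial.monomial (i : ℕ) (y i)).natDegree < n := by
  refine lt_of_le_of_lt (Polynomial.natDegree_sum_le_of_forall_le (n := n - 1) _ _ fun i _ => ?_)
    (by omega)
  exact (Polynomial.natDegree_monomial_le _).trans (by omega)

theorem Polynomial.coeff_sum_monomial {R : Type} [CommRing R] (y : Fin n → R) (i : Fin n) :
    (∑ j : Fin n, Polynomial.monomial (j : ℕ) (y j)).coeff i = y i := by
  simp [Polynomial.finsetSum_coeff, Polynomial.coeff_monomial, Fin.val_inj]

/-- Two polynomials related by inversion of the variable with weight `e`: the first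
has degree at most `e`. -/
theorem Polynomial.natDegree_le_of_eval_eq_pow_mul_eval_inv [Infinite K] {p q : Polynomial K}
    (hp : p ≠ 0) {e : ℕ} (h : ∀ t : K, t ≠ 0 → p.eval t = t ^ e * q.eval t⁻¹) :
    p.natDegree ≤ e := by
  have key : Polynomial.X ^ q.natDegree * p = Polynomial.X ^ e * q.reverse := by
    apply Polynomial.eq_of_infinite_eval_eq
    refine Set.Infinite.mono (s := {t | t ≠ 0}) (fun t ht => ?_)
      (Set.finite_singleton 0).infinite_compl
    have ht' : t ≠ 0 := ht
    have : Invertible t⁻¹ := invertibleOfNonzero (inv_ne_zero ht')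
    have h2 := Polynomial.eval₂_reverse_mul_pow (RingHom.id K) t⁻¹ q
    simp only [invOf_eq_inv, inv_inv, inv_pow, ← Polynomial.eval₂_id] at h2 ⊢
    simp only [Polynomial.eval₂_id] at h2 ⊢
    simp only [Set.mem_ofPred_eq, Polynomial.eval_mul, Polynomial.eval_pow, Polynomial.eval_X,
      h t ht', ← h2]
    field_simp
  have h1 := congrArg Polynomial.natDegree key
  rw [Polynomial.natDegree_mul (pow_ne_zero _ Polynomial.X_ne_zero) hp,
    Polynomial.natDegree_X_pow] at h1
  have h2 := Polynomial.natDegree_mul_le (p := (Polynomial.X ^ e : Polynomial K)) (q := q.reverse)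
  rw [Polynomial.natDegree_X_pow] at h2
  have h3 := Polynomial.reverse_natDegree_le q
  omega

/-- The degrees of the forms other than the one of degree `k`, shifted by one. -/
abbrev OtherDegree (n k : ℕ) : Type := {j : Fin n // (j : ℕ) + 1 ≠ k}

theorem card_pi_otherDegree {k : ℕ} (h1 : 1 ≤ k) (h2 : k ≤ n) :
    Fintype.card ((j : OtherDegree n k) → Fin ((j : Fin n) + 1)) = n.factorial / k := by
  rw [Fintype.card_pi]
  simp only [Fintype.card_fin]
  have hk : ((⟨k - 1, by omega⟩ : Fin n) : ℕ) + 1 = k := by simp; omega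
  have h3 : ∏ j : Fin n, ((j : ℕ) + 1) = n.factorial := by
    rw [Fin.prod_univ_eq_prod_range (fun j => j + 1), Finset.prod_range_add_one_eq_factorial]
  have h4 : k * ∏ j : OtherDegree n k, (((j : Fin n) : ℕ) + 1) = n.factorial := by
    rw [← h3, ← Finset.mul_prod_erase _ _ (Finset.mem_univ (⟨k - 1, by omega⟩ : Fin n)), hk]
    congr 1
    refine (Finset.prod_subtype (Finset.univ.erase (⟨k - 1, by omega⟩ : Fin n)) (fun j => ?_)
      (fun j => (j : ℕ) + 1)).symm
    rw [Finset.mem_erase, Ne, Fin.ext_iff]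
    simp
    omega
  rw [← h4, Nat.mul_div_cancel_left _ (by omega)]

/-- The monic polynomial with one root among the nodes of each degree `j + 1 ≠ k`. -/
noncomputable def nodePoly {k : ℕ} (s : ℕ → ℕ → K)
    (i : (j : OtherDegree n k) → Fin ((j : Fin n) + 1)) : Polynomial K :=
  ∏ j : OtherDegree n k, (Polynomial.X - Polynomial.C (s (j : Fin n) (i j)))

theorem nodePoly_monic {k : ℕ} (s : ℕ → ℕ → K)
    (i : (j : OtherDegree n k) → Fin ((j : Fin n) + 1)) : (nodePoly s i).Monic :=
  Polynomial.monic_prod_of_monic _ _ fun _ _ => Polynomial.monic_X_sub_C _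

theorem nodePoly_natDegree {k : ℕ} (h1 : 1 ≤ k) (h2 : k ≤ n) (s : ℕ → ℕ → K)
    (i : (j : OtherDegree n k) → Fin ((j : Fin n) + 1)) : (nodePoly s i).natDegree = n - 1 := by
  rw [nodePoly, Polynomial.natDegree_prod_of_monic _ _ fun _ _ => Polynomial.monic_X_sub_C _]
  simp only [Polynomial.natDegree_X_sub_C, Finset.sum_const, smul_eq_mul, mul_one,
    Finset.card_univ]
  have := Fintype.card_subtype_compl (fun j : Fin n => (j : ℕ) + 1 = k)
  have h3 : Fintype.card {j : Fin n // (j : ℕ) + 1 = k} = 1 := by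
    rw [Fintype.card_eq_one_iff]
    refine ⟨⟨⟨k - 1, by omega⟩, by simp; omega⟩, fun j => ?_⟩
    have := j.2
    ext
    simp
    omega
  rw [Fintype.card_fin, h3] at this
  exact this

theorem nodePoly_eval_eq_zero_iff {k : ℕ} (s : ℕ → ℕ → K)
    (i : (j : OtherDegree n k) → Fin ((j : Fin n) + 1)) (r : K) :
    (nodePoly s i).eval r = 0 ↔ ∃ j : OtherDegree n k, r = s (j : Fin n) (i j) := by
  simp [nodePoly, Polynomial.eval_prod, Finset.prod_eq_zero_iff, sub_eq_zero]

theorem nodePoly_injective {k : ℕ} {s : ℕ → ℕ → K} (hs : Function.Injective2 s) :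
    Function.Injective (nodePoly s :
      ((j : OtherDegree n k) → Fin ((j : Fin n) + 1)) → Polynomial K) := by
  intro i i' h
  funext j
  have h1 : (nodePoly s i).eval (s (j : Fin n) (i j)) = 0 :=
    (nodePoly_eval_eq_zero_iff s i _).2 ⟨j, rfl⟩
  rw [h, nodePoly_eval_eq_zero_iff] at h1
  obtain ⟨j', hj'⟩ := h1
  obtain ⟨h2, h3⟩ := hs hj'
  have : j = j' := Subtype.ext (Fin.ext h2)
  subst this
  exact Fin.ext h3

theorem Polynomial.exists_eval_injective [Infinite K] {ι : Type} [Finite ι] {f : ι → Polynomial K}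
    (hf : Function.Injective f) : ∃ r, Function.Injective fun i => (f i).eval r := by
  classical
  cases nonempty_fintype ι
  have : ∏ x ∈ Finset.univ.filter (fun x : ι × ι => x.1 ≠ x.2), (f x.1 - f x.2) ≠ 0 := by
    refine Finset.prod_ne_zero_iff.2 fun x hx => sub_ne_zero.2 fun h => ?_
    exact (Finset.mem_filter.1 hx).2 (hf h)
  obtain ⟨r, hr⟩ : ∃ r, Polynomial.eval r (∏ x ∈ Finset.univ.filter
      (fun x : ι × ι => x.1 ≠ x.2), (f x.1 - f x.2)) ≠ 0 := by
    by_contra! h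
    exact this (Polynomial.funext fun r => by simpa using h r)
  refine ⟨r, fun i i' h => ?_⟩
  by_contra hne
  rw [Polynomial.eval_prod, Finset.prod_ne_zero_iff] at hr
  exact hr (i, i') (Finset.mem_filter.2 ⟨Finset.mem_univ _, hne⟩) (by simpa [sub_eq_zero] using h)

/-- For each `k` there is a pencil of tail forms, with only the form of degree `k` varying, that
has exactly `n! / k` degenerate members. -/
theorem exists_pencil [CharZero K] {d k : ℕ} (hd : n ≤ d) (h1 : 1 ≤ k) (h2 : k ≤ n) :
    ∃ (c c' : (Fin (n + 1) →₀ ℕ) → K) (T : Finset K), T.card = n.factorial / k ∧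
      ∀ (t : K) (b : (Fin (n + 1) →₀ ℕ) → K), (∀ a ∈ tailIndex n d k, b a = c a - t * c' a) →
        (∀ a ∉ tailIndex n d k, b a = c a) → (Degenerate d b ↔ t ∈ T) := by
  classical
  let s : ℕ → ℕ → K := fun j i => (Nat.pair j i : ℕ)
  have hs : Function.Injective2 s := by
    intro j j' i i' h
    exact Nat.pair_eq_pair.1 (Nat.cast_injective h)
  obtain ⟨τ, hτ⟩ := Polynomial.exists_eval_injective (nodePoly_injective (n := n) (k := k) hs)
  let last : Fin n := ⟨n - 1, by omega⟩
  let L : K → MvPolynomial (Fin n) K := fun r =>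
    ∑ l : Fin n, MvPolynomial.C (r ^ (l : ℕ)) * MvPolynomial.X l
  have hL : ∀ r, (L r).IsHomogeneous 1 := fun r =>
    MvPolynomial.IsHomogeneous.sum _ _ _ fun l _ => MvPolynomial.isHomogeneous_C_mul_X _ _
  let Y : (Fin n → K) → Polynomial K := fun y => ∑ i : Fin n, Polynomial.monomial (i : ℕ) (y i)
  have hLY : ∀ r y, MvPolynomial.eval y (L r) = (Y y).eval r := by
    intro r y
    rw [sum_coeff_mul_pow_eq_eval]
    simp [L]
  let g : ℕ → MvPolynomial (Fin n) K := fun m =>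
    if m = k then L τ * MvPolynomial.X last ^ (k - 1) else ∏ i ∈ Finset.range m, L (s (m - 1) i)
  let g' : ℕ → MvPolynomial (Fin n) K := fun m => MvPolynomial.X last ^ m
  have hg : ∀ m, (g m).IsHomogeneous m := by
    intro m
    by_cases hm : m = k
    · have := (hL τ).mul ((MvPolynomial.isHomogeneous_X K last).pow (k - 1))
      simp only [g, if_pos hm]
      convert this using 1
      omega
    · have := MvPolynomial.IsHomogeneous.prod (Finset.range m) (fun i => L (s (m - 1) i))
        (fun _ => 1) fun i _ => hL _
      simpa [g, if_neg hm] using this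
  have hg' : ∀ m, (g' m).IsHomogeneous m := fun m => by
    simpa using (MvPolynomial.isHomogeneous_X K last).pow m
  refine ⟨fun a => (g (d - a 0)).coeff a.tail, fun a => (g' (d - a 0)).coeff a.tail,
    Finset.univ.image fun i => (nodePoly (n := n) (k := k) s i).eval τ, ?_, ?_⟩
  · rw [Finset.card_image_of_injective _ hτ, Finset.card_univ, card_pi_otherDegree h1 h2]
  intro t b hb hb'
  have hk : ∀ y, tailForm d k b y = (Y y).eval τ * y last ^ (k - 1) - t * y last ^ k := by
    intro y
    have : tailForm d k b y = tailForm d k (fun a => 1 * (g (d - a 0)).coeff a.tail -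
        t * (g' (d - a 0)).coeff a.tail) y :=
      tailForm_congr fun a h1 h2 => by rw [hb a ⟨h1, h2⟩, one_mul]
    rw [this, tailForm_sub_mul, tailForm_coeff (by omega) (hg k), tailForm_coeff (by omega) (hg' k)]
    simp [g, g', hLY]
  have hne : ∀ m, m ≤ n → m ≠ k → ∀ y,
      tailForm d m b y = ∏ i ∈ Finset.range m, (Y y).eval (s (m - 1) i) := by
    intro m hm hmk y
    rw [tailForm_congr (c' := fun a => (g (d - a 0)).coeff a.tail),
      tailForm_coeff (by omega) (hg m)]
    · simp [g, hmk, hLY]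
    · intro a ha ha'
      refine hb' a fun h => hmk ?_
      have := h.2
      omega
  rw [Finset.mem_image]
  constructor
  · rintro ⟨y, hy, h⟩
    have h3 : ∀ j : OtherDegree n k, ∃ i : Fin ((j : Fin n) + 1),
        (Y y).eval (s (j : Fin n) i) = 0 := by
      intro j
      have h4 := h ((j : Fin n) + 1) (by omega) (by omega)
      rw [hne _ (by omega) j.2, Finset.prod_eq_zero_iff] at h4
      obtain ⟨i, hi, hi'⟩ := h4
      exact ⟨⟨i, Finset.mem_range.1 hi⟩, by simpa using hi'⟩
    choose i hi using h3
    refine ⟨i, Finset.mem_univ _, ?_⟩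
    have hdvd : nodePoly s i ∣ Y y := by
      refine Finset.prod_dvd_of_coprime (fun j _ j' _ hjj' => ?_) fun j _ =>
        Polynomial.dvd_iff_isRoot.2 (hi j)
      refine Polynomial.isCoprime_X_sub_C_of_isUnit_sub (sub_ne_zero.2 fun h => hjj' ?_).isUnit
      exact Subtype.ext (Fin.ext (hs h).1)
    obtain ⟨w, hw⟩ := hdvd
    have hY : Y y ≠ 0 := by
      intro h0
      apply hy
      funext l
      rw [← Polynomial.coeff_sum_monomial y l]
      exact congrArg (fun p => Polynomial.coeff p l) h0
    have hw0 : w ≠ 0 := by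
      rintro rfl
      exact hY (by rw [hw, mul_zero])
    have hdeg : w.natDegree = 0 := by
      have h5 := Polynomial.natDegree_sum_monomial_lt (by omega) y
      change (Y y).natDegree < n at h5
      rw [hw, Polynomial.natDegree_mul (nodePoly_monic s i).ne_zero hw0,
        nodePoly_natDegree h1 h2] at h5
      omega
    obtain ⟨r, rfl⟩ := Polynomial.natDegree_eq_zero.1 hdeg
    have hr : r ≠ 0 := fun h => hw0 (by rw [h, Polynomial.C_0])
    have hlast : y last = r := by
      rw [← Polynomial.coeff_sum_monomial y last]
      change (Y y).coeff (n - 1) = r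
      rw [hw, Polynomial.coeff_mul_C, ← nodePoly_natDegree h1 h2 s i,
        (nodePoly_monic s i).coeff_natDegree, one_mul]
    have h6 := h k h1 h2
    rw [hk, hlast, hw, Polynomial.eval_mul, Polynomial.eval_C] at h6
    have h7 : r ^ k = r * r ^ (k - 1) := by
      rw [← pow_succ']
      congr 1
      omega
    rw [h7] at h6
    have h8 : (Polynomial.eval τ (nodePoly s i) - t) * r ^ k = 0 := by
      rw [h7]
      linear_combination h6
    exact sub_eq_zero.1 ((mul_eq_zero.1 h8).resolve_right (pow_ne_zero _ hr))
  · rintro ⟨i, -, rfl⟩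
    have hlt : (nodePoly s i).natDegree < n := by
      rw [nodePoly_natDegree h1 h2]
      omega
    have hY : Y (fun l => (nodePoly s i).coeff l) = nodePoly s i :=
      Polynomial.sum_monomial_coeff_of_natDegree_lt hlt
    have hlast : (nodePoly s i).coeff (last : ℕ) = 1 := by
      change (nodePoly s i).coeff (n - 1) = 1
      rw [← nodePoly_natDegree h1 h2 s i, (nodePoly_monic s i).coeff_natDegree]
    refine ⟨fun l => (nodePoly s i).coeff l, fun h => ?_, fun m hm1 hm2 => ?_⟩
    · have := congrFun h last
      rw [hlast] at this
      exact one_ne_zero this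
    · by_cases hmk : m = k
      · subst hmk
        rw [hk, hY, hlast]
        simp
      · rw [hne m hm2 hmk, hY]
        let j : OtherDegree n k := ⟨⟨m - 1, by omega⟩, by
          simp only
          omega⟩
        refine Finset.prod_eq_zero (i := (i j : ℕ)) ?_ ?_
        · have hj : ((j : Fin n) : ℕ) = m - 1 := rfl
          have := (i j).2
          rw [Finset.mem_range]
          omega
        · exact (nodePoly_eval_eq_zero_iff s i _).2 ⟨j, rfl⟩

theorem exists_not_degenerate [CharZero K] {d : ℕ} (hn : 1 ≤ n) (hd : n ≤ d) :
    ∃ c : (Fin (n + 1) →₀ ℕ) → K, ¬ Degenerate d c := by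
  classical
  obtain ⟨c, c', T, -, hT⟩ := exists_pencil (K := K) hd hn le_rfl
  obtain ⟨t, ht⟩ := Infinite.exists_notMem_finset T
  refine ⟨fun a => if a ∈ tailIndex n d n then c a - t * c' a else c a, ?_⟩
  rwa [hT t _ (fun a ha => if_pos ha) (fun a ha => if_neg ha)]

theorem factorial_div_le_degree [CharZero K] {d k : ℕ} (hd : n ≤ d) (h1 : 1 ≤ k) (h2 : k ≤ n)
    {p : MvPolynomial (Fin (n + 1) →₀ ℕ) K}
    (h : ∀ c, MvPolynomial.eval c p = 0 ↔ Degenerate d c) {e : ℕ}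
    (he : ∀ (r : K) c, MvPolynomial.eval (scaleOn (tailIndex n d k) r c) p =
      r ^ e * MvPolynomial.eval c p) : n.factorial / k ≤ e := by
  classical
  obtain ⟨c, c', T, hcard, hT⟩ := exists_pencil (K := K) hd h1 h2
  let b : K → (Fin (n + 1) →₀ ℕ) → K := fun t a =>
    if a ∈ tailIndex n d k then c a - t * c' a else c a
  let b' : K → (Fin (n + 1) →₀ ℕ) → K := fun t a =>
    if a ∈ tailIndex n d k then t * c a - c' a else c a
  let q : Polynomial K := MvPolynomial.aeval (fun a => if a ∈ tailIndex n d k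
    then Polynomial.C (c a) - Polynomial.X * Polynomial.C (c' a) else Polynomial.C (c a)) p
  let q' : Polynomial K := MvPolynomial.aeval (fun a => if a ∈ tailIndex n d k
    then Polynomial.X * Polynomial.C (c a) - Polynomial.C (c' a) else Polynomial.C (c a)) p
  have hq : ∀ t, q.eval t = MvPolynomial.eval (b t) p := by
    intro t
    rw [MvPolynomial.eval_aeval_polynomial]
    congr 2
    funext a
    by_cases ha : a ∈ tailIndex n d k
    · simp [b, ha]
      ring
    · simp [b, ha]
  have hq' : ∀ t, q'.eval t = MvPolynomial.eval (b' t) p := by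
    intro t
    rw [MvPolynomial.eval_aeval_polynomial]
    congr 2
    funext a
    by_cases ha : a ∈ tailIndex n d k
    · simp [b', ha]
      ring
    · simp [b', ha]
  have hroot : ∀ t, q.eval t = 0 ↔ t ∈ T := by
    intro t
    rw [hq, h]
    exact hT t _ (fun a ha => if_pos ha) (fun a ha => if_neg ha)
  have hq0 : q ≠ 0 := by
    intro h0
    obtain ⟨t, ht⟩ := Infinite.exists_notMem_finset T
    exact ht ((hroot t).1 (by rw [h0, Polynomial.eval_zero]))
  have hdeg : q.natDegree ≤ e := by
    refine Polynomial.natDegree_le_of_eval_eq_pow_mul_eval_inv hq0 (q := q') fun t ht => ?_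
    rw [hq, hq', ← he]
    congr 2
    funext a
    by_cases ha : a ∈ tailIndex n d k
    · simp only [b, b', scaleOn, ha, if_true]
      field_simp
    · simp only [b, b', scaleOn, ha, if_false]
  calc n.factorial / k = T.card := hcard.symm
    _ ≤ q.roots.toFinset.card := Finset.card_le_card fun t ht => by
      rw [Multiset.mem_toFinset, Polynomial.mem_roots hq0]
      exact (hroot t).2 ht
    _ ≤ q.natDegree := (Multiset.toFinset_card_le _).trans (Polynomial.card_roots' q)
    _ ≤ e := hdeg

end LowerBound

/-! ### Irreducibility of the degeneracy condition -/

section Irreducible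

variable {R S K : Type} [CommRing R] [CommRing S] [Field K] {n : ℕ}

/-- The coefficients of `e_k(y) h_k - h_k(y) e_k`, where `h_k` and `e_k` are the tail forms of
degree `k` with coefficients `h` and `e`. -/
def eliminate (d : ℕ) (h e : (Fin (n + 1) →₀ ℕ) → R) (y : Fin n → R) :
    (Fin (n + 1) →₀ ℕ) → R :=
  fun a => if 1 ≤ d - a 0 ∧ d - a 0 ≤ n then
    tailForm d (d - a 0) e y * h a - tailForm d (d - a 0) h y * e a else h a

theorem map_eliminate (φ : R →+* S) (d : ℕ) (h e : (Fin (n + 1) →₀ ℕ) → R) (y : Fin n → R)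
    (a : Fin (n + 1) →₀ ℕ) :
    φ (eliminate d h e y a) =
      eliminate d (fun a => φ (h a)) (fun a => φ (e a)) (fun i => φ (y i)) a := by
  unfold eliminate
  split_ifs
  · simp [map_tailForm]
  · rfl

theorem tailForm_eliminate {d k : ℕ} (h1 : 1 ≤ k) (h2 : k ≤ n)
    (h e : (Fin (n + 1) →₀ ℕ) → R) (y z : Fin n → R) :
    tailForm d k (eliminate d h e y) z =
      tailForm d k e y * tailForm d k h z - tailForm d k h y * tailForm d k e z := by
  rw [← tailForm_sub_mul]
  refine tailForm_congr fun a _ ha => ?_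
  have : d - a 0 = k := by omega
  rw [eliminate, this, if_pos ⟨h1, h2⟩]

theorem degenerate_eliminate (hn : 1 ≤ n) (d : ℕ) (h e : (Fin (n + 1) →₀ ℕ) → K) (y : Fin n → K) :
    Degenerate d (eliminate d h e y) := by
  by_cases hy : y = 0
  · refine ⟨1, fun h0 => one_ne_zero (congrFun h0 ⟨0, hn⟩), fun k h1 h2 => ?_⟩
    rw [tailForm_eliminate h1 h2, hy, tailForm_zero_right (by omega),
      tailForm_zero_right (by omega), zero_mul, zero_mul, sub_zero]
  · refine ⟨y, hy, fun k h1 h2 => ?_⟩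
    rw [tailForm_eliminate h1 h2, mul_comm, sub_self]

theorem Degenerate.exists_eliminate_eq {d : ℕ} {c : (Fin (n + 1) →₀ ℕ) → K}
    (hc : Degenerate d c) : ∃ e y, eliminate d c e y = c := by
  obtain ⟨y, hy, hcy⟩ := hc
  obtain ⟨j, hj⟩ := Function.ne_iff.1 hy
  let g : ℕ → MvPolynomial (Fin n) K := fun k =>
    MvPolynomial.C ((y j)⁻¹ ^ k) * MvPolynomial.X j ^ k
  refine ⟨fun a => (g (d - a 0)).coeff a.tail, y, funext fun a => ?_⟩
  unfold eliminate
  split_ifs with ha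
  · rw [hcy _ ha.1 ha.2, tailForm_coeff (Nat.sub_le _ _)
      (MvPolynomial.isHomogeneous_C_mul_X_pow _ _ _)]
    have hj' : y j ≠ 0 := hj
    simp [g, hj']
  · rfl

/-- The locus of degenerate coefficients is irreducible. -/
theorem eval_eq_zero_of_degenerate_of_mul [Infinite K] (hn : 1 ≤ n) {d : ℕ}
    {p q : MvPolynomial (Fin (n + 1) →₀ ℕ) K}
    (h : ∀ c, Degenerate d c → MvPolynomial.eval c (p * q) = 0) :
    (∀ c, Degenerate d c → MvPolynomial.eval c p = 0) ∨
      ∀ c, Degenerate d c → MvPolynomial.eval c q = 0 := by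
  let σ := (Fin (n + 1) →₀ ℕ) ⊕ (Fin (n + 1) →₀ ℕ) ⊕ Fin n
  let ψ : MvPolynomial (Fin (n + 1) →₀ ℕ) K →ₐ[K] MvPolynomial σ K := MvPolynomial.aeval
    (eliminate d (fun a => MvPolynomial.X (Sum.inl a))
      (fun a => MvPolynomial.X (Sum.inr (Sum.inl a)))
      (fun i => MvPolynomial.X (Sum.inr (Sum.inr i))))
  have heval : ∀ (v : σ → K) f, MvPolynomial.eval v (ψ f) = MvPolynomial.eval
      (eliminate d (fun a => v (Sum.inl a)) (fun a => v (Sum.inr (Sum.inl a)))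
        (fun i => v (Sum.inr (Sum.inr i)))) f := by
    intro v f
    have : (MvPolynomial.aeval v).comp ψ = MvPolynomial.aeval
      (eliminate d (fun a => v (Sum.inl a)) (fun a => v (Sum.inr (Sum.inl a)))
        (fun i => v (Sum.inr (Sum.inr i)))) := by
      ext1 a
      rw [AlgHom.comp_apply, MvPolynomial.aeval_X, MvPolynomial.aeval_X,
        MvPolynomial.aeval_eq_eval, map_eliminate]
      simp
    have h2 := DFunLike.congr_fun this f
    simpa [MvPolynomial.aeval_eq_eval] using h2
  have hzero : ∀ f, ψ f = 0 → ∀ c, Degenerate d c → MvPolynomial.eval c f = 0 := by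
    intro f hf c hc
    obtain ⟨e, y, hey⟩ := hc.exists_eliminate_eq
    have := heval (Sum.elim c (Sum.elim e y)) f
    simp only [Sum.elim_inl, Sum.elim_inr] at this
    rw [hf, map_zero, hey] at this
    exact this.symm
  have hψ : ψ p * ψ q = 0 := by
    rw [← map_mul]
    refine MvPolynomial.funext fun v => ?_
    rw [heval, map_zero]
    exact h _ (degenerate_eliminate hn d _ _ _)
  exact (mul_eq_zero.1 hψ).imp (hzero p) (hzero q)

theorem isUnit_of_mul_of_degenerate [IsAlgClosed K] [CharZero K] {d : ℕ} (hn : 1 ≤ n) (hd : n ≤ d)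
    {p q : MvPolynomial (Fin (n + 1) →₀ ℕ) K}
    (h : ∀ c, MvPolynomial.eval c (p * q) = 0 ↔ Degenerate d c)
    (hdeg : ∀ (r : K) c, MvPolynomial.eval (fun a => r * c a) (p * q) =
      r ^ (∑ k ∈ Finset.Icc 1 n, n.factorial / k) * MvPolynomial.eval c (p * q))
    (hp : ∀ c, Degenerate d c → MvPolynomial.eval c p = 0) : IsUnit q := by
  have hp' : ∀ c, MvPolynomial.eval c p = 0 ↔ Degenerate d c := fun c =>
    ⟨fun hc => (h c).1 (by rw [map_mul, hc, zero_mul]), hp c⟩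
  obtain ⟨c₀, hc₀⟩ := exists_not_degenerate (K := K) hn hd
  have hp0 : p ≠ 0 := by
    rintro rfl
    exact hc₀ ((hp' c₀).1 (map_zero _))
  obtain ⟨e, he1, he2⟩ := exists_degree_of_eval_eq_zero_iff_degenerate hp0 hp'
  have hle : ∑ k ∈ Finset.Icc 1 n, n.factorial / k ≤ ∑ k ∈ Finset.Icc 1 n, e k :=
    Finset.sum_le_sum fun k hk => factorial_div_le_degree hd (Finset.mem_Icc.1 hk).1
      (Finset.mem_Icc.1 hk).2 hp' (he1 k)
  obtain ⟨m, hm⟩ := Nat.exists_eq_add_of_le hle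
  have hq : ∀ c, ¬ Degenerate d c → MvPolynomial.eval c q = MvPolynomial.eval 0 q * 0 ^ m := by
    intro c hc
    let u : Polynomial K := MvPolynomial.aeval (fun a => Polynomial.X * Polynomial.C (c a)) q
    have hu : ∀ t, u.eval t = MvPolynomial.eval (fun a => t * c a) q := fun t => by
      rw [MvPolynomial.eval_aeval_polynomial]
      simp only [Polynomial.eval_mul, Polynomial.eval_X, Polynomial.eval_C]
    have hpc : MvPolynomial.eval c p ≠ 0 := fun h0 => hc ((hp' c).1 h0)
    have hne : ∀ t, t ≠ 0 → t ^ m * u.eval t = MvPolynomial.eval c q := by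
      intro t ht
      have h3 := hdeg t c
      rw [map_mul, map_mul, he2, hm, pow_add] at h3
      have h4 : t ^ (∑ k ∈ Finset.Icc 1 n, n.factorial / k) ≠ 0 := pow_ne_zero _ ht
      rw [hu]
      refine mul_left_cancel₀ (mul_ne_zero h4 hpc) ?_
      linear_combination h3
    have hpoly : Polynomial.X * (Polynomial.X ^ m * u - Polynomial.C (MvPolynomial.eval c q)) =
        0 := by
      refine Polynomial.funext fun t => ?_
      by_cases ht : t = 0
      · simp [ht]
      · simp [← hne t ht]
    have h0 := congrArg (Polynomial.eval 0)
      ((mul_eq_zero.1 hpoly).resolve_left Polynomial.X_ne_zero)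
    simp only [Polynomial.eval_sub, Polynomial.eval_mul, Polynomial.eval_pow, Polynomial.eval_X,
      Polynomial.eval_C, Polynomial.eval_zero, hu, zero_mul, sub_eq_zero] at h0
    rw [← h0, mul_comm]
    rfl
  have hconst : p * (q - MvPolynomial.C (MvPolynomial.eval 0 q * 0 ^ m)) = 0 := by
    refine MvPolynomial.funext fun c => ?_
    by_cases hc : Degenerate d c
    · rw [map_mul, hp c hc, zero_mul, map_zero]
    · rw [map_mul, map_sub, MvPolynomial.eval_C, hq c hc, sub_self, mul_zero, map_zero]
  have hqC := sub_eq_zero.1 ((mul_eq_zero.1 hconst).resolve_left hp0)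
  rw [hqC]
  refine (IsUnit.mk0 _ fun h0 => hc₀ ((h c₀).1 ?_)).map MvPolynomial.C
  rw [map_mul, hq c₀ hc₀, h0, mul_zero]

theorem irreducible_of_eval_eq_zero_iff_degenerate [IsAlgClosed K] [CharZero K] {d : ℕ}
    (hn : 1 ≤ n) (hd : n ≤ d) {p : MvPolynomial (Fin (n + 1) →₀ ℕ) K}
    (h : ∀ c, MvPolynomial.eval c p = 0 ↔ Degenerate d c)
    (hdeg : ∀ (r : K) c, MvPolynomial.eval (fun a => r * c a) p =
      r ^ (∑ k ∈ Finset.Icc 1 n, n.factorial / k) * MvPolynomial.eval c p) :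
    Irreducible p := by
  refine ⟨fun hu => ?_, fun a b hab => ?_⟩
  · have h0 := (h 0).2 ⟨1, fun h0 => one_ne_zero (congrFun h0 ⟨0, hn⟩), fun k _ _ => by
      simp [tailForm]⟩
    exact (hu.map (MvPolynomial.eval 0)).ne_zero h0
  · subst hab
    rcases eval_eq_zero_of_degenerate_of_mul hn fun c hc => (h c).2 hc with ha | hb
    · exact Or.inr (isUnit_of_mul_of_degenerate hn hd h hdeg ha)
    · rw [mul_comm] at h hdeg
      exact Or.inl (isUnit_of_mul_of_degenerate hn hd h hdeg hb)

end Irreducible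

/-! ### The flex criterion -/

section Flex

variable {R S : Type} [CommRing R] [CommRing S] {n : ℕ}

theorem map_lineRestrict (φ : R →+* S) (x y : Fin (n + 1) → R)
    (f : MvPolynomial (Fin (n + 1)) R) :
    (lineRestrict x y f).map φ =
      lineRestrict (fun i => φ (x i)) (fun i => φ (y i)) (MvPolynomial.map φ f) := by
  induction f using MvPolynomial.induction_on with
  | C a => simp [lineRestrict]
  | add p q hp hq => simp [hp, hq]
  | mul_X p i hp => simp [hp]; simp [lineRestrict]

/-- The directional Taylor coefficient of `f` at the point `x`, as a polynomial in the
direction. -/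
noncomputable def polarForm (x : Fin (n + 1) → R) (f : MvPolynomial (Fin (n + 1)) R) (k : ℕ) :
    MvPolynomial (Fin (n + 1)) R :=
  (k.factorial : MvPolynomial (Fin (n + 1)) R) *
    (lineRestrict (fun i => MvPolynomial.C (x i)) MvPolynomial.X
      (MvPolynomial.map MvPolynomial.C f)).coeff k

theorem polarForm_isHomogeneous (x : Fin (n + 1) → R) (f : MvPolynomial (Fin (n + 1)) R) (k : ℕ) :
    (polarForm x f k).IsHomogeneous k := by
  have h : ((lineRestrict (fun i => MvPolynomial.C (x i)) MvPolynomial.X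
      (MvPolynomial.map MvPolynomial.C f)).coeff k).IsHomogeneous k := by
    induction f using MvPolynomial.induction_on generalizing k with
    | C a =>
      simp only [MvPolynomial.map_C, lineRestrict, MvPolynomial.aeval_C,
        Polynomial.algebraMap_apply, Polynomial.coeff_C]
      split_ifs with hk
      · subst hk
        exact MvPolynomial.isHomogeneous_C _ _
      · exact MvPolynomial.isHomogeneous_zero _ _ _
    | add p q hp hq =>
      rw [map_add, map_add, Polynomial.coeff_add]
      exact (hp k).add (hq k)
    | mul_X p i hp =>
      have hX : lineRestrict (fun i => MvPolynomial.C (x i)) MvPolynomial.X (MvPolynomial.X i) =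
          Polynomial.C (MvPolynomial.C (x i)) + Polynomial.X *
            Polynomial.C (MvPolynomial.X i : MvPolynomial (Fin (n + 1)) R) := by
        simp [lineRestrict]
      rw [map_mul, map_mul, MvPolynomial.map_X, hX, mul_add, Polynomial.coeff_add,
        Polynomial.coeff_mul_C, ← mul_assoc, Polynomial.coeff_mul_C]
      have hC := (hp k).mul (MvPolynomial.isHomogeneous_C (Fin (n + 1)) (x i))
      rw [add_zero] at hC
      refine hC.add ?_
      cases k with
      | zero =>
        rw [Polynomial.coeff_mul_X_zero, zero_mul]
        exact MvPolynomial.isHomogeneous_zero _ _ _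
      | succ k =>
        rw [Polynomial.coeff_mul_X]
        exact (hp k).mul (MvPolynomial.isHomogeneous_X _ _)
  have h' := (MvPolynomial.isHomogeneous_C (Fin (n + 1)) (k.factorial : R)).mul h
  rw [map_natCast, zero_add] at h'
  exact h'

theorem eval_polarForm (x y : Fin (n + 1) → R) (f : MvPolynomial (Fin (n + 1)) R) (k : ℕ) :
    MvPolynomial.eval y (polarForm x f k) = k.factorial * (lineRestrict x y f).coeff k := by
  have h : (MvPolynomial.eval y).comp MvPolynomial.C = RingHom.id R := by
    ext a
    simp
  rw [polarForm, map_mul, map_natCast, ← Polynomial.coeff_map, map_lineRestrict,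
    MvPolynomial.map_map, h, MvPolynomial.map_id]
  simp

theorem map_dirCoeffY (φ : MvPolynomial (Fin (n + 1)) R →+* S)
    (f : MvPolynomial (Fin (n + 1)) R) (k : ℕ) :
    MvPolynomial.map φ (dirCoeffY f k) = polarForm (fun i => φ (MvPolynomial.X i))
      (MvPolynomial.map (φ.comp MvPolynomial.C) f) k := by
  have h : (MvPolynomial.aeval (fun i => Polynomial.C (MvPolynomial.C (MvPolynomial.X i)) +
      Polynomial.X * Polynomial.C (MvPolynomial.X i)) f :
        Polynomial (MvPolynomial (Fin (n + 1)) (MvPolynomial (Fin (n + 1)) R))) =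
      lineRestrict (fun i => MvPolynomial.C (MvPolynomial.X i)) MvPolynomial.X
        (MvPolynomial.map (MvPolynomial.C.comp MvPolynomial.C) f) := by
    induction f using MvPolynomial.induction_on with
    | C a =>
      rw [MvPolynomial.aeval_C, MvPolynomial.map_C, lineRestrict, MvPolynomial.aeval_C]
      rfl
    | add p q hp hq => rw [map_add, map_add, map_add, hp, hq]
    | mul_X p i hp =>
      rw [map_mul, map_mul, map_mul, hp, MvPolynomial.map_X, lineRestrict, MvPolynomial.aeval_X,
        MvPolynomial.aeval_X]
  have h2 : (MvPolynomial.map φ).comp (MvPolynomial.C.comp MvPolynomial.C) =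
      (MvPolynomial.C (σ := Fin (n + 1))).comp (φ.comp (MvPolynomial.C (σ := Fin (n + 1)))) := by
    ext a
    simp
  rw [dirCoeffY, polarForm, h, map_mul, map_natCast, ← Polynomial.coeff_map, map_lineRestrict,
    MvPolynomial.map_map, MvPolynomial.map_map, h2]
  simp

variable {K : Type} [Field K] [Algebra K S]

/-- The specialization of the coefficients to `c` and of the variables to `x`. -/
noncomputable def specialize (c : (Fin (n + 1) →₀ ℕ) → S) (x : Fin (n + 1) → S) :
    MvPolynomial (Fin (n + 1)) (MvPolynomial (Fin (n + 1) →₀ ℕ) K) →ₐ[K] S :=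
  MvPolynomial.aevalTower (MvPolynomial.aeval c) x

theorem specialize_C (c : (Fin (n + 1) →₀ ℕ) → S) (x : Fin (n + 1) → S)
    (p : MvPolynomial (Fin (n + 1) →₀ ℕ) K) :
    specialize c x (MvPolynomial.C p) = MvPolynomial.aeval c p := by
  simp [specialize]

theorem specialize_X (c : (Fin (n + 1) →₀ ℕ) → S) (x : Fin (n + 1) → S) (i : Fin (n + 1)) :
    specialize (K := K) c x (MvPolynomial.X i) = x i := by
  simp [specialize]

theorem specialize_eq_eval (c : (Fin (n + 1) →₀ ℕ) → S) (x : Fin (n + 1) → S)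
    (f : MvPolynomial (Fin (n + 1)) (MvPolynomial (Fin (n + 1) →₀ ℕ) K)) :
    specialize c x f =
      MvPolynomial.eval x (MvPolynomial.map ((MvPolynomial.aeval c : _ →ₐ[K] S) : _ →+* S) f) := by
  induction f using MvPolynomial.induction_on with
  | C a =>
    rw [specialize_C, MvPolynomial.map_C, MvPolynomial.eval_C]
    rfl
  | add p q hp hq => simp [hp, hq]
  | mul_X p i hp => simp [hp, specialize_X]

theorem specialize_genericPoly (d : ℕ) (c : (Fin (n + 1) →₀ ℕ) → S) (x : Fin (n + 1) → S) :
    specialize c x (genericPoly K n d) = MvPolynomial.eval x (formOf d c) := by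
  rw [specialize_eq_eval, genericPoly_eq_formOf, map_formOf]
  simp

theorem map_specialize {T : Type} [CommRing T] [Algebra K T] (φ : S →ₐ[K] T)
    (c : (Fin (n + 1) →₀ ℕ) → S) (x : Fin (n + 1) → S)
    (f : MvPolynomial (Fin (n + 1)) (MvPolynomial (Fin (n + 1) →₀ ℕ) K)) :
    φ (specialize c x f) = specialize (fun a => φ (c a)) (fun i => φ (x i)) f := by
  induction f using MvPolynomial.induction_on with
  | C a =>
    rw [specialize_C, specialize_C, ← MvPolynomial.comp_aeval_apply]
  | add p q hp hq => simp [hp, hq]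
  | mul_X p i hp => simp [hp, specialize_X]

/-- `Φ` vanishes at a point `x` of a hypersurface exactly if the hypersurface has contact of order
greater than `n` at `x` with some line. -/
def IsFlexPolynomial (d : ℕ)
    (Φ : MvPolynomial (Fin (n + 1)) (MvPolynomial (Fin (n + 1) →₀ ℕ) K)) : Prop :=
  ∀ (c : (Fin (n + 1) →₀ ℕ) → K) (x : Fin (n + 1) → K) (ℓ : MvPolynomial (Fin (n + 1)) K),
    ℓ.IsHomogeneous 1 → MvPolynomial.eval x (formOf d c) = 0 → MvPolynomial.eval x ℓ ≠ 0 →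
    (specialize c x Φ = 0 ↔ ∃ y, y ≠ 0 ∧ MvPolynomial.eval y ℓ = 0 ∧
      ∀ k, 1 ≤ k → k ≤ n → (lineRestrict x y (formOf d c)).coeff k = 0)

theorem exists_resultant_polarForm_eq {d : ℕ}
    {Res : ∀ (R : Type) [CommRing R] [Algebra K R],
      (Fin (n + 1) → MvPolynomial (Fin (n + 1)) R) → R}
    (hnat : ∀ (R : Type) [CommRing R] [Algebra K R] (S : Type) [CommRing S] [Algebra K S]
      (φ : R →ₐ[K] S) (sys : Fin (n + 1) → MvPolynomial (Fin (n + 1)) R),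
      Res S (fun i => MvPolynomial.map (φ : R →+* S) (sys i)) = φ (Res R sys))
    {Φ : MvPolynomial (Fin (n + 1)) (MvPolynomial (Fin (n + 1) →₀ ℕ) K)}
    {ℓ : MvPolynomial (Fin (n + 1)) K}
    (hcong : genericPoly K n d ∣
        (Res (MvPolynomial (Fin (n + 1)) (MvPolynomial (Fin (n + 1) →₀ ℕ) K))
            (Fin.lastCases
              (MvPolynomial.map
                (algebraMap K (MvPolynomial (Fin (n + 1)) (MvPolynomial (Fin (n + 1) →₀ ℕ) K))) ℓ)
              (fun j : Fin n => dirCoeffY (genericPoly K n d) ((j : ℕ) + 1))) -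
          (MvPolynomial.map
            (algebraMap K (MvPolynomial (Fin (n + 1) →₀ ℕ) K)) ℓ) ^ n.factorial * Φ))
    (c : (Fin (n + 1) →₀ ℕ) → S) (x : Fin (n + 1) → S) :
    ∃ b, Res S (Fin.lastCases (MvPolynomial.map (algebraMap K S) ℓ)
        (fun j : Fin n => polarForm x (formOf d c) ((j : ℕ) + 1))) =
      MvPolynomial.aeval x ℓ ^ n.factorial * specialize c x Φ +
        MvPolynomial.eval x (formOf d c) * b := by
  obtain ⟨b, hb⟩ := hcong
  refine ⟨specialize c x b, ?_⟩
  have h := congrArg (specialize (K := K) c x) hb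
  rw [map_mul, specialize_genericPoly, map_sub, map_mul, map_pow, ← hnat, sub_eq_iff_eq_add'] at h
  have hℓ : specialize (K := K) c x (MvPolynomial.map (algebraMap K _) ℓ) =
      MvPolynomial.aeval x ℓ := by
    rw [specialize_eq_eval, MvPolynomial.map_map, MvPolynomial.aeval_def,
      MvPolynomial.eval_map]
    congr 1
    exact (MvPolynomial.aeval c : _ →ₐ[K] S).comp_algebraMap
  rw [← hℓ, ← h]
  congr 1
  funext i
  refine Fin.lastCases ?_ (fun j => ?_) i
  · simp only [Fin.lastCases_last, MvPolynomial.map_map]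
    congr 2
    exact (specialize (K := K) c x).comp_algebraMap.symm
  · simp only [Fin.lastCases_castSucc]
    rw [map_dirCoeffY, genericPoly_eq_formOf, map_formOf]
    simp [specialize_X, specialize_C]

theorem isFlexPolynomial_of_resultant [CharZero K] {d : ℕ}
    {Res : ∀ (R : Type) [CommRing R] [Algebra K R],
      (Fin (n + 1) → MvPolynomial (Fin (n + 1)) R) → R}
    (hvan : ∀ sys : Fin (n + 1) → MvPolynomial (Fin (n + 1)) K,
      (∀ i, (sys i).IsHomogeneous (Fin.lastCases 1 (fun j : Fin n => (j : ℕ) + 1) i)) →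
      (Res K sys = 0 ↔ ∃ z : Fin (n + 1) → K, z ≠ 0 ∧ ∀ i, MvPolynomial.eval z (sys i) = 0))
    {Φ : MvPolynomial (Fin (n + 1)) (MvPolynomial (Fin (n + 1) →₀ ℕ) K)}
    (h : ∀ (c : (Fin (n + 1) →₀ ℕ) → K) (x : Fin (n + 1) → K) (ℓ : MvPolynomial (Fin (n + 1)) K),
      ℓ.IsHomogeneous 1 → MvPolynomial.eval x (formOf d c) = 0 →
      Res K (Fin.lastCases ℓ (fun j : Fin n => polarForm x (formOf d c) ((j : ℕ) + 1))) =
        MvPolynomial.eval x ℓ ^ n.factorial * specialize c x Φ) :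
    IsFlexPolynomial d Φ := by
  intro c x ℓ hℓ hx hxℓ
  have h1 := h c x ℓ hℓ hx
  rw [← mul_eq_zero_iff_left (pow_ne_zero n.factorial hxℓ), ← h1, hvan]
  · refine exists_congr fun y => and_congr_right fun _ => ?_
    rw [Fin.forall_fin_succ']
    simp only [Fin.lastCases_last, Fin.lastCases_castSucc, eval_polarForm, mul_eq_zero,
      Nat.cast_eq_zero, Nat.factorial_ne_zero, false_or]
    rw [and_comm]
    refine and_congr_right fun _ => ⟨fun h k h1 h2 => ?_, fun h j => h _ (by omega) (by omega)⟩
    have := h ⟨k - 1, by omega⟩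
    rwa [Nat.sub_add_cancel h1] at this
  · intro i
    refine Fin.lastCases ?_ (fun j => ?_) i
    · simpa using hℓ
    · simpa using polarForm_isHomogeneous _ _ _

end Flex

/-! ### Hypersurfaces without flexes at a coordinate point -/

section Contact

variable {K : Type} [Field K] {n : ℕ}

/-- The form `∑ x_p^{d - k} z_k^k`, where `z_1, …, z_n` are the variables other than `x_p`. -/
noncomputable def contactForm (R : Type) [CommRing R] (d : ℕ) (p : Fin (n + 1)) :
    MvPolynomial (Fin (n + 1)) R :=
  ∑ k : Fin n, MvPolynomial.X p ^ (d - (k + 1)) * MvPolynomial.X (p.succAbove k) ^ (k + 1 : ℕ)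

theorem contactForm_isHomogeneous {R : Type} [CommRing R] {d : ℕ} (hd : n ≤ d) (p : Fin (n + 1)) :
    (contactForm R d p).IsHomogeneous d := by
  refine MvPolynomial.IsHomogeneous.sum _ _ _ fun k _ => ?_
  have h := (MvPolynomial.isHomogeneous_X_pow (R := R) p (d - (k + 1))).mul
    (MvPolynomial.isHomogeneous_X_pow (R := R) (p.succAbove k) (k + 1 : ℕ))
  rwa [Nat.sub_add_cancel (by omega)] at h

theorem eval_contactForm {R : Type} [CommRing R] (d : ℕ) (p : Fin (n + 1)) :
    MvPolynomial.eval (Pi.single p 1) (contactForm R d p) = 0 := by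
  simp [contactForm]

theorem coeff_lineRestrict_contactForm {R : Type} [CommRing R] (d : ℕ) (p : Fin (n + 1))
    {y : Fin (n + 1) → R} (hy : y p = 0) (k : Fin n) :
    (lineRestrict (Pi.single p 1) y (contactForm R d p)).coeff (k + 1) =
      y (p.succAbove k) ^ (k + 1 : ℕ) := by
  have h : lineRestrict (Pi.single p 1) y (contactForm R d p) =
      ∑ k : Fin n, Polynomial.monomial (k + 1 : ℕ) (y (p.succAbove k) ^ (k + 1 : ℕ)) := by
    rw [contactForm, map_sum]
    refine Finset.sum_congr rfl fun k _ => ?_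
    rw [← Polynomial.C_mul_X_pow_eq_monomial]
    simp [lineRestrict, hy, mul_pow]
  rw [h, Polynomial.finsetSum_coeff, Finset.sum_eq_single k]
  · simp
  · intro j _ hj
    rw [Polynomial.coeff_monomial, if_neg]
    simpa [Fin.ext_iff] using hj
  · simp

theorem IsFlexPolynomial.specialize_contactForm_ne_zero {d : ℕ}
    {Φ : MvPolynomial (Fin (n + 1)) (MvPolynomial (Fin (n + 1) →₀ ℕ) K)}
    (h : IsFlexPolynomial d Φ) (hd : n ≤ d) (p : Fin (n + 1)) :
    specialize (fun a => (contactForm K d p).coeff a) (Pi.single p 1) Φ ≠ 0 := by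
  have hf := formOf_coeff (contactForm_isHomogeneous (R := K) hd p)
  rw [Ne, h _ _ (MvPolynomial.X p) (MvPolynomial.isHomogeneous_X _ _)
    (by rw [hf, eval_contactForm]) (by simp)]
  rintro ⟨y, hy, hyp, hk⟩
  rw [MvPolynomial.eval_X] at hyp
  refine hy (funext fun i => ?_)
  rcases Fin.eq_self_or_eq_succAbove p i with rfl | ⟨k, rfl⟩
  · exact hyp
  · have := hk (k + 1) (by omega) (by omega)
    rw [hf, coeff_lineRestrict_contactForm d p hyp] at this
    exact pow_eq_zero_iff (by omega) |>.1 this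

theorem aeval_mul_of_isHomogeneous {R S ι : Type} [CommRing R] [CommRing S] [Algebra R S] {m : ℕ}
    {p : MvPolynomial ι R} (hp : p.IsHomogeneous m) (r : S) (c : ι → S) :
    MvPolynomial.aeval (fun a => r * c a) p = r ^ m * MvPolynomial.aeval c p := by
  rw [MvPolynomial.aeval_def, MvPolynomial.aeval_def, MvPolynomial.eval₂_eq,
    MvPolynomial.eval₂_eq, Finset.mul_sum]
  refine Finset.sum_congr rfl fun a ha => ?_
  have hdeg : ∑ i ∈ a.support, a i = m := by
    by_contra h
    exact MvPolynomial.mem_support_iff.1 ha (hp.coeff_eq_zero h)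
  simp only [mul_pow]
  rw [Finset.prod_mul_distrib, Finset.prod_pow_eq_pow_sum, hdeg]
  ring

theorem specialize_monomial {S : Type} [CommRing S] [Algebra K S] (c : (Fin (n + 1) →₀ ℕ) → S)
    (x : Fin (n + 1) → S) (a : Fin (n + 1) →₀ ℕ) (p : MvPolynomial (Fin (n + 1) →₀ ℕ) K) :
    specialize c x (MvPolynomial.monomial a p) =
      MvPolynomial.aeval c p * a.prod fun i e => x i ^ e := by
  rw [specialize_eq_eval, MvPolynomial.map_monomial, MvPolynomial.eval_monomial]
  rfl

theorem specialize_mul_of_isHomogeneous {S : Type} [CommRing S] [Algebra K S] {m : ℕ}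
    {Φ : MvPolynomial (Fin (n + 1)) (MvPolynomial (Fin (n + 1) →₀ ℕ) K)}
    (h : ∀ a, (Φ.coeff a).IsHomogeneous m) (r : S) (c : (Fin (n + 1) →₀ ℕ) → S)
    (x : Fin (n + 1) → S) :
    specialize (fun a => r * c a) x Φ = r ^ m * specialize c x Φ := by
  rw [Φ.as_sum, map_sum, map_sum, Finset.mul_sum]
  refine Finset.sum_congr rfl fun a _ => ?_
  rw [specialize_monomial, specialize_monomial, aeval_mul_of_isHomogeneous (h a), mul_assoc]

end Contact

/-! ### Binary forms have no universal flex polynomial -/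

section Binary

variable {K : Type} [Field K]

theorem polarForm_contactForm_one {R : Type} [CommRing R] (d : ℕ) (r : R) :
    polarForm (Pi.single 0 1) (MvPolynomial.C r * contactForm (n := 1) R d 0) 1 =
      MvPolynomial.C r * MvPolynomial.X 1 := by
  have h2 : (lineRestrict (fun i => MvPolynomial.C ((Pi.single 0 1 : Fin 2 → R) i))
      MvPolynomial.X (MvPolynomial.map MvPolynomial.C (MvPolynomial.C r * contactForm R d 0))) =
      Polynomial.C (MvPolynomial.C r * MvPolynomial.X 1) *
        (1 + Polynomial.X * Polynomial.C (MvPolynomial.X 0)) ^ (d - 1) * Polynomial.X := by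
    simp [lineRestrict, contactForm]
    ring
  rw [polarForm, h2, Polynomial.coeff_mul_X, Polynomial.coeff_zero_eq_eval_zero]
  simp

theorem polarForm_X_pow {R : Type} [CommRing R] (d : ℕ) (r : R) :
    polarForm (Pi.single 1 r) (MvPolynomial.X 1 ^ d : MvPolynomial (Fin (1 + 1)) R) 1 =
      MvPolynomial.C (d * r ^ (d - 1)) * MvPolynomial.X 1 := by
  have h2 : (lineRestrict (fun i => MvPolynomial.C ((Pi.single 1 r : Fin (1 + 1) → R) i))
      MvPolynomial.X (MvPolynomial.map MvPolynomial.C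
        (MvPolynomial.X 1 ^ d : MvPolynomial (Fin (1 + 1)) R))) =
      (Polynomial.C (MvPolynomial.C r) + Polynomial.X * Polynomial.C (MvPolynomial.X 1)) ^ d := by
    simp [lineRestrict]
  have h3 : ∀ p : Polynomial (MvPolynomial (Fin (1 + 1)) R),
      p.coeff 1 = p.derivative.eval 0 := fun p => by
    rw [← Polynomial.coeff_zero_eq_eval_zero, Polynomial.coeff_derivative]
    simp
  rw [polarForm, h2, h3]
  simp [Polynomial.derivative_pow]

theorem false_of_binary_resultant [CharZero K] {d : ℕ} (hd : 1 ≤ d)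
    {Res : ∀ (R : Type) [CommRing R] [Algebra K R],
      (Fin (1 + 1) → MvPolynomial (Fin (1 + 1)) R) → R}
    (hnat : ∀ (R : Type) [CommRing R] [Algebra K R] (S : Type) [CommRing S] [Algebra K S]
      (φ : R →ₐ[K] S) (sys : Fin (1 + 1) → MvPolynomial (Fin (1 + 1)) R),
      Res S (fun i => MvPolynomial.map (φ : R →+* S) (sys i)) = φ (Res R sys))
    {Φ : MvPolynomial (Fin (1 + 1)) (MvPolynomial (Fin (1 + 1) →₀ ℕ) K)}
    (hΦ : IsFlexPolynomial d Φ) (hΦc : ∀ m, (Φ.coeff m).IsHomogeneous 1)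
    (h : ∀ (ℓ : MvPolynomial (Fin (1 + 1)) K) (c : (Fin (1 + 1) →₀ ℕ) → Polynomial K)
      (x : Fin (1 + 1) → Polynomial K), ℓ.IsHomogeneous 1 →
      ∃ b, Res (Polynomial K) (Fin.lastCases (MvPolynomial.map (algebraMap K (Polynomial K)) ℓ)
        (fun j : Fin 1 => polarForm x (formOf d c) ((j : ℕ) + 1))) =
      MvPolynomial.aeval x ℓ ^ Nat.factorial 1 * specialize c x Φ +
        MvPolynomial.eval x (formOf d c) * b) : False := by
  have hne := hΦ.specialize_contactForm_ne_zero hd 0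
  set κ := specialize (fun a => (contactForm K d 0).coeff a) (Pi.single (0 : Fin (1 + 1)) 1) Φ
    with hκ
  let sys : Polynomial K → Fin (1 + 1) → MvPolynomial (Fin (1 + 1)) (Polynomial K) := fun r =>
    Fin.lastCases (MvPolynomial.X 0) fun _ => MvPolynomial.C r * MvPolynomial.X 1
  have hsys : ∀ (r : Polynomial K) (c : (Fin (1 + 1) →₀ ℕ) → Polynomial K)
      (x : Fin (1 + 1) → Polynomial K),
      polarForm x (formOf d c) 1 = MvPolynomial.C r * MvPolynomial.X 1 →
      ∃ b, Polynomial.aeval r (Res (Polynomial K) (sys Polynomial.X)) = x 0 * specialize c x Φ +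
        MvPolynomial.eval x (formOf d c) * b := by
    intro r c x hr
    obtain ⟨b, hb⟩ := h (MvPolynomial.X 0) c x (MvPolynomial.isHomogeneous_X _ _)
    rw [MvPolynomial.aeval_X, Nat.factorial_one, pow_one] at hb
    refine ⟨b, ?_⟩
    rw [← hb, ← hnat]
    congr 1
    funext i
    refine Fin.lastCases ?_ (fun j => ?_) i
    · simp only [sys, Fin.lastCases_last, MvPolynomial.map_X]
    · have hj : (j : ℕ) + 1 = 1 := by omega
      simp only [sys, Fin.lastCases_castSucc, hj, hr, map_mul, MvPolynomial.map_X,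
        MvPolynomial.map_C]
      simp
  have h1 : Res (Polynomial K) (sys Polynomial.X) = Polynomial.X * Polynomial.C κ := by
    let c : (Fin (1 + 1) →₀ ℕ) → Polynomial K := fun a =>
      Polynomial.X * Polynomial.C ((contactForm K d 0).coeff a)
    have hmap : MvPolynomial.map Polynomial.C (contactForm K d (0 : Fin (1 + 1))) =
        contactForm (Polynomial K) d 0 := by
      simp [contactForm]
    have hc : formOf d c = MvPolynomial.C Polynomial.X * contactForm (Polynomial K) d 0 := by
      rw [← hmap, ← formOf_coeff (contactForm_isHomogeneous (R := K) hd 0), map_formOf, formOf,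
        formOf, Finset.mul_sum]
      simp only [c, MvPolynomial.C_mul_monomial]
    obtain ⟨b, hb⟩ := hsys Polynomial.X c (Pi.single 0 1)
      (by rw [hc, polarForm_contactForm_one])
    rw [hc, map_mul, eval_contactForm, mul_zero, zero_mul, add_zero, Pi.single_eq_same, one_mul,
      specialize_mul_of_isHomogeneous hΦc, pow_one] at hb
    have h2 := map_specialize (Polynomial.CAlgHom (R := K) (A := K))
      (fun a => (contactForm K d 0).coeff a) (Pi.single (0 : Fin (1 + 1)) 1) Φ
    have h3 : (fun i => Polynomial.CAlgHom (R := K)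
        ((Pi.single (0 : Fin (1 + 1)) 1 : Fin (1 + 1) → K) i)) = Pi.single 0 1 := by
      funext i
      by_cases hi : i = 0
      · subst hi
        simp
      · simp [hi]
    rw [h3] at h2
    rw [hκ]
    refine Eq.trans ?_ (hb.trans (congrArg (Polynomial.X * ·) h2.symm))
    simp
  let c : (Fin (1 + 1) →₀ ℕ) → Polynomial K := fun a =>
    (MvPolynomial.X 1 ^ d : MvPolynomial (Fin (1 + 1)) (Polynomial K)).coeff a
  have hc : formOf d c = MvPolynomial.X 1 ^ d :=
    formOf_coeff (MvPolynomial.isHomogeneous_X_pow _ _)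
  obtain ⟨b, hb⟩ := hsys _ c (Pi.single 1 Polynomial.X) (by rw [hc, polarForm_X_pow])
  rw [h1, hc] at hb
  have h4 : Polynomial.C (d * κ) * Polynomial.X ^ (d - 1) = Polynomial.X ^ d * b := by
    rw [map_mul, Polynomial.aeval_X, Polynomial.aeval_C, Polynomial.algebraMap_eq,
      Pi.single_eq_of_ne (by decide), zero_mul, zero_add, map_pow, MvPolynomial.eval_X,
      Pi.single_eq_same] at hb
    rw [← hb, map_mul, map_natCast]
    ring
  have h5 := congrArg (fun p => Polynomial.coeff p (d - 1)) h4
  simp only [Polynomial.coeff_C_mul, Polynomial.coeff_X_pow_self, mul_one,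
    Polynomial.coeff_X_pow_mul'] at h5
  rw [if_neg (by omega)] at h5
  exact mul_ne_zero (Nat.cast_ne_zero.2 (by omega)) hne h5

end Binary

/-! ### The variable `x₀` modulo `F` and `Φ` -/

section NonZeroDivisor

theorem Ideal.mem_span_pair_of_mul_mem {R : Type} [CommRing R] [IsDomain R] {f g t r : R}
    (ω : R →+* R) (ht0 : t ≠ 0) (ht : ω t = 0) (hω : ∀ s, t ∣ s - ω s) (hf : Prime (ω f))
    (hg : ¬ ω f ∣ ω g) (hr : t * r ∈ Ideal.span {f, g}) : r ∈ Ideal.span {f, g} := by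
  have hdvd : ∀ s, ω s = 0 → t ∣ s := fun s hs => by simpa [hs] using hω s
  have hidem : ∀ s, ω (ω s) = ω s := fun s => by
    obtain ⟨u, hu⟩ := hω s
    have := congrArg ω hu
    rw [map_sub, map_mul, ht, zero_mul, sub_eq_zero] at this
    exact this.symm
  obtain ⟨a, b, hab⟩ := Ideal.mem_span_pair.1 hr
  have h1 := congrArg ω hab
  rw [map_add, map_mul, map_mul, map_mul, ht, zero_mul] at h1
  obtain ⟨u, hu⟩ := (hf.dvd_or_dvd (Dvd.intro_left (-ω a) (by linear_combination -h1) :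
    ω f ∣ ω b * ω g)).resolve_right hg
  obtain ⟨v, hv⟩ := hdvd (b - f * u) (by
    have := congrArg ω hu
    rw [hidem, map_mul, hidem] at this
    rw [map_sub, map_mul, this, sub_self])
  have h2 : f * (a + u * g) = t * (r - v * g) := by
    linear_combination hab - g * hv
  have h3 := congrArg ω h2
  rw [map_mul, map_mul, ht, zero_mul] at h3
  obtain ⟨w, hw⟩ := hdvd _ ((mul_eq_zero.1 h3).resolve_left hf.ne_zero)
  have h4 : r - v * g = f * w := mul_left_cancel₀ ht0 (by rw [← h2, hw]; ring)
  exact Ideal.mem_span_pair.2 ⟨w, v, by linear_combination -h4⟩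

variable {K : Type} [Field K] {n : ℕ}

/-- The substitution `x₀ ↦ 0`. -/
noncomputable def killZero (R : Type) [CommRing R] (n : ℕ) :
    MvPolynomial (Fin (n + 1)) R →ₐ[R] MvPolynomial (Fin (n + 1)) R :=
  MvPolynomial.aeval fun i => if i = 0 then 0 else MvPolynomial.X i

theorem X_zero_dvd_sub_killZero {R : Type} [CommRing R] (f : MvPolynomial (Fin (n + 1)) R) :
    MvPolynomial.X 0 ∣ f - killZero R n f := by
  induction f using MvPolynomial.induction_on with
  | C a => simp [killZero, MvPolynomial.algebraMap_eq]
  | add p q hp hq =>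
    rw [map_add, add_sub_add_comm]
    exact dvd_add hp hq
  | mul_X p i hp =>
    rw [map_mul]
    by_cases hi : i = 0
    · subst hi
      simp [killZero]
    · have : killZero R n (MvPolynomial.X i) = MvPolynomial.X i := by simp [killZero, hi]
      rw [this, ← sub_mul]
      exact hp.mul_right _

theorem killZero_formOf {R : Type} [CommRing R] (d : ℕ) (c : (Fin (n + 1) →₀ ℕ) → R) :
    killZero R n (formOf d c) = formOf d fun a => if a 0 = 0 then c a else 0 := by
  rw [formOf, map_sum]
  refine Finset.sum_congr rfl fun a _ => ?_
  rw [killZero, MvPolynomial.aeval_monomial, MvPolynomial.monomial_eq, MvPolynomial.algebraMap_eq,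
    Finsupp.prod_fintype _ _ (fun _ => pow_zero _), Finsupp.prod_fintype _ _ (fun _ => pow_zero _)]
  beta_reduce
  split_ifs with ha
  · congr 1
    refine Finset.prod_congr rfl fun i _ => ?_
    split_ifs with hi
    · rw [hi, ha, pow_zero, pow_zero]
    · rfl
  · rw [map_zero, zero_mul, Finset.prod_eq_zero (Finset.mem_univ 0), mul_zero]
    rw [if_pos rfl, zero_pow ha]

theorem specialize_killZero (c : (Fin (n + 1) →₀ ℕ) → K) {x : Fin (n + 1) → K} (hx : x 0 = 0)
    (f : MvPolynomial (Fin (n + 1)) (MvPolynomial (Fin (n + 1) →₀ ℕ) K)) :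
    specialize c x (killZero _ n f) = specialize c x f := by
  obtain ⟨g, hg⟩ := X_zero_dvd_sub_killZero f
  have := congrArg (specialize c x) hg
  rw [map_sub, map_mul, specialize_X, hx, zero_mul, sub_eq_zero] at this
  exact this.symm

theorem irreducible_killZero_genericPoly (hn : 2 ≤ n) (d : ℕ) :
    Irreducible (killZero _ n (genericPoly K n d)) := by
  classical
  let s : Finset (Fin (n + 1) →₀ ℕ) := Finset.finsuppAntidiag Finset.univ d
  let c : (Fin (n + 1) →₀ ℕ) →₀ MvPolynomial (Fin (n + 1)) K := Finsupp.onFinset s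
    (fun a => if ∑ i, a i = d ∧ a 0 = 0 then MvPolynomial.monomial a 1 else 0)
    (fun a ha => mem_finsuppAntidiag_univ_iff.2 (by
      by_contra h
      simp [h] at ha))
  have hc : ∀ i : Fin (n + 1), i ≠ 0 → c (Finsupp.single i d) = MvPolynomial.X i ^ d := by
    intro i hi
    simp [c, hi, Finsupp.single_apply, MvPolynomial.X_pow_eq_monomial]
  have heq : MvPolynomial.commAlgEquiv K (Fin (n + 1)) (Fin (n + 1) →₀ ℕ)
      (killZero _ n (genericPoly K n d)) = MvPolynomial.sumSMulX c := by
    rw [genericPoly_eq_formOf, killZero_formOf, formOf, map_sum, MvPolynomial.sumSMulX,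
      Finsupp.linearCombination_onFinset]
    refine Finset.sum_congr rfl fun a ha => ?_
    rw [mem_finsuppAntidiag_univ_iff] at ha
    by_cases h0 : a 0 = 0
    · rw [if_pos h0, if_pos ⟨ha, h0⟩, MvPolynomial.smul_eq_C_mul, mul_comm]
      simp only [MvPolynomial.monomial_eq, map_mul, MvPolynomial.commAlgEquiv_C_X, map_one, one_mul,
        Finsupp.prod, map_prod, map_pow, MvPolynomial.commAlgEquiv_X]
    · simp [h0]
  refine .of_map (f := MvPolynomial.commAlgEquiv K (Fin (n + 1)) (Fin (n + 1) →₀ ℕ)) ?_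
  rw [heq]
  let i₁ : Fin (n + 1) := ⟨1, by omega⟩
  let i₂ : Fin (n + 1) := ⟨2, by omega⟩
  have h1 : i₁ ≠ 0 := by simp [i₁, Fin.ext_iff]
  have h2 : i₂ ≠ 0 := by simp [i₂, Fin.ext_iff]
  refine MvPolynomial.irreducible_sumSMulX c ⟨Finsupp.single i₁ d, ?_⟩ fun r hr => ?_
  · rw [Finsupp.mem_support_iff, hc i₁ h1]
    exact pow_ne_zero _ (MvPolynomial.X_ne_zero _)
  · have hrel : IsRelPrime (MvPolynomial.X i₁ : MvPolynomial (Fin (n + 1)) K)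
        (MvPolynomial.X i₂) := by
      refine (MvPolynomial.X_prime.irreducible.isRelPrime_iff_not_dvd).2 fun h => ?_
      have := map_dvd (MvPolynomial.eval (Pi.single i₂ 1)) h
      simp [i₁, i₂] at this
    exact hrel.pow (by rw [← hc i₁ h1]; exact hr _) (by rw [← hc i₂ h2]; exact hr _)

theorem IsFlexPolynomial.mem_span_of_X_zero_mul_mem {d : ℕ} (hn : 2 ≤ n) (hd : n ≤ d)
    {Φ f : MvPolynomial (Fin (n + 1)) (MvPolynomial (Fin (n + 1) →₀ ℕ) K)}
    (h : IsFlexPolynomial d Φ)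
    (hf : MvPolynomial.X 0 * f ∈ Ideal.span {genericPoly K n d, Φ}) :
    f ∈ Ideal.span {genericPoly K n d, Φ} := by
  have hp : Prime (killZero _ n (genericPoly K n d)) :=
    UniqueFactorizationMonoid.irreducible_iff_prime.1 (irreducible_killZero_genericPoly hn d)
  have hX : killZero (MvPolynomial (Fin (n + 1) →₀ ℕ) K) n (MvPolynomial.X 0) = 0 := by
    simp [killZero]
  refine Ideal.mem_span_pair_of_mul_mem (killZero _ n).toRingHom (MvPolynomial.X_ne_zero 0)
    hX X_zero_dvd_sub_killZero hp ?_ hf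
  let i₁ : Fin (n + 1) := ⟨1, by omega⟩
  have h1 : (Pi.single i₁ 1 : Fin (n + 1) → K) 0 = 0 :=
    Pi.single_eq_of_ne (by simp [i₁, Fin.ext_iff]) _
  intro (hdvd : killZero _ n (genericPoly K n d) ∣ killZero _ n Φ)
  have h2 := map_dvd (specialize (fun a => (contactForm K d i₁).coeff a) (Pi.single i₁ 1)) hdvd
  rw [specialize_killZero _ h1, specialize_killZero _ h1, specialize_genericPoly,
    formOf_coeff (contactForm_isHomogeneous hd i₁), eval_contactForm, zero_dvd_iff] at h2
  exact h.specialize_contactForm_ne_zero hd i₁ h2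

end NonZeroDivisor

/-! ### Moving a point to a coordinate point -/

section Flatten

variable {R S K : Type} [CommRing R] [CommRing S] [Field K] {n : ℕ}

/-- The vector `(0, r x₁, …, r xₙ)`. -/
def ratio (x : Fin (n + 1) → R) (r : R) : Fin (n + 1) → R := fun i => if i = 0 then 0 else x i * r

open Classical in
/-- The coefficients `c` with the coefficient of `x₀ ^ d` removed, after the substitution
`x ↦ x - r x₀ (0, x₁, …, xₙ)`. -/
noncomputable def flatten (d : ℕ) (x : Fin (n + 1) → R) (r : R) (c : (Fin (n + 1) →₀ ℕ) → R) :
    (Fin (n + 1) →₀ ℕ) → R :=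
  twist d (-ratio x r) fun a => if a = Finsupp.single 0 d then 0 else c a

theorem map_ratio (φ : R →+* S) (x : Fin (n + 1) → R) (r : R) (i : Fin (n + 1)) :
    φ (ratio x r i) = ratio (fun i => φ (x i)) (φ r) i := by
  unfold ratio
  split_ifs <;> simp

theorem map_flatten (φ : R →+* S) (d : ℕ) (x : Fin (n + 1) → R) (r : R)
    (c : (Fin (n + 1) →₀ ℕ) → R) (a : Fin (n + 1) →₀ ℕ) :
    φ (flatten d x r c a) = flatten d (fun i => φ (x i)) (φ r) (fun a => φ (c a)) a := by
  rw [flatten, map_twist, flatten]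
  congr 1
  · funext i
    simp [map_ratio]
  · funext a
    split_ifs <;> simp

theorem add_neg_ratio_mul {x : Fin (n + 1) → R} {r : R} (h : x 0 * r = 1) (i : Fin (n + 1)) :
    x i + (-ratio x r) i * x 0 = (Fin.cons (x 0) 0 : Fin (n + 1) → R) i := by
  refine Fin.cases ?_ (fun j => ?_) i
  · simp [ratio]
  · simp only [Pi.neg_apply, ratio, Fin.succ_ne_zero, if_false, Fin.cons_succ, Pi.zero_apply]
    linear_combination (-x j.succ) * h

theorem coeff_lineRestrict_flatten {d k : ℕ} (hk : k ≠ 0) {x : Fin (n + 1) → R} {r : R}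
    (h : x 0 * r = 1) (c : (Fin (n + 1) →₀ ℕ) → R) (y : Fin n → R) :
    (lineRestrict x (Fin.cons 0 y) (formOf d (flatten d x r c))).coeff k =
      x 0 ^ (d - k) * tailForm d k c y := by
  rw [flatten, formOf_twist, lineRestrict_shear]
  simp only [add_neg_ratio_mul h, Fin.cons_zero, mul_zero, add_zero]
  rw [coeff_lineRestrict_formOf]
  congr 1
  refine tailForm_congr fun a _ ha => if_neg ?_
  rintro rfl
  rw [Finsupp.single_eq_same] at ha
  omega

theorem eval_cons_zero_formOf (d : ℕ) (r : R) (c : (Fin (n + 1) →₀ ℕ) → R) :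
    MvPolynomial.eval (Fin.cons r 0) (formOf d c) = r ^ d * c (Finsupp.single 0 d) := by
  have h : (Fin.cons r 0 : Fin (n + 1) → R) = fun i => r * (Pi.single 0 1 : Fin (n + 1) → R) i := by
    funext i
    refine Fin.cases ?_ (fun j => ?_) i
    · simp
    · simp
  rw [h, ← MvPolynomial.aeval_eq_eval, aeval_mul_of_isHomogeneous (formOf_isHomogeneous d c),
    MvPolynomial.aeval_eq_eval, ← (formOf_isHomogeneous d c).coeff_single_eq_eval, coeff_formOf,
    if_pos]
  simp [Finsupp.single_apply]

theorem eval_formOf_flatten (d : ℕ) {x : Fin (n + 1) → R} {r : R} (h : x 0 * r = 1)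
    (c : (Fin (n + 1) →₀ ℕ) → R) : MvPolynomial.eval x (formOf d (flatten d x r c)) = 0 := by
  rw [flatten, formOf_twist, eval_shear]
  simp only [add_neg_ratio_mul h]
  rw [eval_cons_zero_formOf, if_pos rfl, mul_zero]

theorem flatten_twist_ratio {d : ℕ} {x : Fin (n + 1) → R} {r : R} (h : x 0 * r = 1)
    {c : (Fin (n + 1) →₀ ℕ) → R} (hc : MvPolynomial.eval x (formOf d c) = 0) :
    flatten d x r (twist d (ratio x r) c) = c := by
  have h0 : ratio x r 0 = 0 := if_pos rfl
  have h1 : (fun i => if i = 0 then 1 else ratio x r i) = fun i => r * x i := by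
    funext i
    by_cases hi : i = 0
    · rw [if_pos hi, hi, mul_comm, h]
    · rw [if_neg hi, ratio, if_neg hi, mul_comm]
  have h2 : twist d (ratio x r) c (Finsupp.single 0 d) = 0 := by
    rw [twist_single_zero d _ h0, h1, ← MvPolynomial.aeval_eq_eval,
      aeval_mul_of_isHomogeneous (formOf_isHomogeneous d c), MvPolynomial.aeval_eq_eval, hc,
      mul_zero]
  have h3 := twist_twist_neg d (-ratio x r) (by rw [Pi.neg_apply, h0, neg_zero]) c
  rw [neg_neg] at h3
  refine (congrArg (twist d (-ratio x r)) (funext fun a => ?_)).trans h3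
  split_ifs with ha
  · rw [ha, h2]
  · rfl

theorem IsFlexPolynomial.specialize_flatten_eq_zero_iff {d : ℕ}
    {Φ : MvPolynomial (Fin (n + 1)) (MvPolynomial (Fin (n + 1) →₀ ℕ) K)}
    (h : IsFlexPolynomial d Φ) {x : Fin (n + 1) → K} (hx : x 0 ≠ 0)
    (c : (Fin (n + 1) →₀ ℕ) → K) :
    specialize (flatten d x (x 0)⁻¹ c) x Φ = 0 ↔ Degenerate d c := by
  have hr : x 0 * (x 0)⁻¹ = 1 := mul_inv_cancel₀ hx
  rw [h _ x (MvPolynomial.X 0) (MvPolynomial.isHomogeneous_X _ _) (eval_formOf_flatten d hr c)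
    (by simpa using hx)]
  simp only [MvPolynomial.eval_X]
  have hiff : ∀ y : Fin n → K, (∀ k, 1 ≤ k → k ≤ n →
      (lineRestrict x (Fin.cons 0 y) (formOf d (flatten d x (x 0)⁻¹ c))).coeff k = 0) ↔
      ∀ k, 1 ≤ k → k ≤ n → tailForm d k c y = 0 := fun y => forall_congr' fun k =>
    forall₂_congr fun h1 h2 => by
      rw [coeff_lineRestrict_flatten (by omega) hr, mul_eq_zero, or_iff_right (pow_ne_zero _ hx)]
  constructor
  · rintro ⟨y, hy, hy0, hk⟩
    have hcons : Fin.cons 0 (Fin.tail y) = y := by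
      rw [← hy0, Fin.cons_self_tail]
    refine ⟨Fin.tail y, fun ht => hy ?_, (hiff _).1 (by rwa [hcons])⟩
    rw [← hcons, ht]
    exact funext (Fin.cases rfl fun _ => rfl)
  · rintro ⟨y, hy, hk⟩
    refine ⟨Fin.cons 0 y, fun h0 => hy (funext fun i => ?_), rfl, (hiff y).2 hk⟩
    simpa using congrFun h0 i.succ

end Flatten

/-! ### Primality -/

section Prime

variable {K : Type} [Field K] {n : ℕ}

variable (K n) in
/-- The polynomial ring in the coefficient indeterminates and the variables. -/
abbrev GenericRing : Type := MvPolynomial (Fin (n + 1)) (MvPolynomial (Fin (n + 1) →₀ ℕ) K)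

theorem algHom_eq_specialize {S : Type} [CommRing S] [Algebra K S]
    (φ : GenericRing K n →ₐ[K] S) (f : GenericRing K n) :
    φ f = specialize (fun a => φ (MvPolynomial.C (MvPolynomial.X a)))
      (fun i => φ (MvPolynomial.X i)) f := by
  have h : (specialize (fun a => MvPolynomial.C (MvPolynomial.X a)) MvPolynomial.X :
      GenericRing K n →ₐ[K] GenericRing K n) f = f := by
    induction f using MvPolynomial.induction_on with
    | C p =>
      rw [specialize_C]
      induction p using MvPolynomial.induction_on with
      | C a =>
        rw [MvPolynomial.aeval_C]
        rfl
      | add p q hp hq => rw [map_add, map_add, hp, hq]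
      | mul_X p i hp => rw [map_mul, map_mul, hp, MvPolynomial.aeval_X]
    | add p q hp hq => rw [map_add, hp, hq]
    | mul_X p i hp => rw [map_mul, hp, specialize_X]
  rw [← map_specialize, h]

variable {T : Type} [CommRing T] [Algebra K T] [Algebra (GenericRing K n) T]
  [IsScalarTower K (GenericRing K n) T]

variable (K n T) in
/-- The variables in an algebra over the polynomial ring. -/
noncomputable def varIn (i : Fin (n + 1)) : T :=
  algebraMap (GenericRing K n) T (MvPolynomial.X i)

variable (K n T) in
/-- The coefficient indeterminates in an algebra over the polynomial ring. -/
noncomputable def coeffIn (a : Fin (n + 1) →₀ ℕ) : T :=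
  algebraMap (GenericRing K n) T (MvPolynomial.C (MvPolynomial.X a))

theorem algebraMap_eq_specialize (f : GenericRing K n) :
    algebraMap (GenericRing K n) T f = specialize (coeffIn K n T) (varIn K n T) f :=
  algHom_eq_specialize (IsScalarTower.toAlgHom K (GenericRing K n) T) f

variable [IsLocalization.Away (MvPolynomial.X 0 : GenericRing K n) T]

/-- Every specialization with `x₀` a unit extends to the localization at `x₀`. -/
theorem exists_algHom_extending {S : Type} [CommRing S] [Algebra K S]
    (c : (Fin (n + 1) →₀ ℕ) → S) (x : Fin (n + 1) → S) (hx : IsUnit (x 0)) :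
    ∃ φ : T →ₐ[K] S, ∀ f, φ (algebraMap (GenericRing K n) T f) = specialize c x f := by
  have hu : IsUnit (((specialize c x : GenericRing K n →ₐ[K] S) : GenericRing K n →+* S)
      (MvPolynomial.X 0)) := by
    simpa [specialize_X] using hx
  have h : ∀ f, IsLocalization.Away.lift (S := T) (MvPolynomial.X 0 : GenericRing K n) hu
      (algebraMap (GenericRing K n) T f) = specialize c x f := fun f =>
    IsLocalization.Away.lift_eq _ hu f
  refine ⟨⟨IsLocalization.Away.lift (MvPolynomial.X 0 : GenericRing K n) hu, fun r => ?_⟩, h⟩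
  rw [IsScalarTower.algebraMap_apply K (GenericRing K n) T]
  exact (h _).trans ((specialize c x : GenericRing K n →ₐ[K] S).commutes r)

variable (K n T) in
/-- The inverse of the first variable. -/
noncomputable def invVar : T :=
  IsLocalization.Away.invSelf (MvPolynomial.X 0 : GenericRing K n)

omit [Algebra K T] [IsScalarTower K (GenericRing K n) T] in
theorem varIn_zero_mul_invVar : varIn K n T 0 * invVar K n T = 1 :=
  IsLocalization.Away.mul_invSelf _

variable (K T) in
/-- The homomorphism from the polynomial ring to its localization at `x₀` which kills the generic
form by eliminating the coefficient of `x₀ ^ d`. -/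
noncomputable def eliminateTop (d : ℕ) : GenericRing K n →ₐ[K] T :=
  specialize (flatten d (varIn K n T) (invVar K n T) (coeffIn K n T)) (varIn K n T)

omit [IsScalarTower K (GenericRing K n) T] in
theorem eliminateTop_genericPoly (d : ℕ) : eliminateTop K T d (genericPoly K n d) = 0 := by
  rw [eliminateTop, specialize_genericPoly, eval_formOf_flatten d varIn_zero_mul_invVar]

theorem exists_algHom_eliminateTop (d : ℕ) : ∃ β : T →ₐ[K] T, ∀ f,
    β (eliminateTop K T d f) - algebraMap (GenericRing K n) T f ∈
        Ideal.span {algebraMap (GenericRing K n) T (genericPoly K n d)} := by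
  obtain ⟨β, hβ⟩ := exists_algHom_extending (K := K) (T := T)
    (twist d (ratio (varIn K n T) (invVar K n T)) (coeffIn K n T)) (varIn K n T)
    (IsUnit.of_mul_eq_one _ varIn_zero_mul_invVar)
  have hvar : ∀ i, β (varIn K n T i) = varIn K n T i := fun i => by
    rw [varIn, hβ, specialize_X, varIn]
  have hcoeff : ∀ a, β (coeffIn K n T a) =
      twist d (ratio (varIn K n T) (invVar K n T)) (coeffIn K n T) a := fun a => by
    rw [coeffIn, hβ, specialize_C, MvPolynomial.aeval_X]
  have hinv : β (invVar K n T) = invVar K n T := by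
    have h1 := congrArg β (varIn_zero_mul_invVar (K := K) (n := n) (T := T))
    rw [map_mul, hvar, map_one] at h1
    exact (left_inv_eq_right_inv ((mul_comm _ _).trans varIn_zero_mul_invVar) h1).symm
  refine ⟨β, fun f => ?_⟩
  set J : Ideal T := Ideal.span {algebraMap (GenericRing K n) T (genericPoly K n d)} with hJ
  rw [← Ideal.Quotient.eq]
  have hmk : ∀ t, Ideal.Quotient.mk J t = Ideal.Quotient.mkₐ K J t := fun _ => rfl
  rw [algebraMap_eq_specialize (T := T), eliminateTop, map_specialize, hmk, hmk, map_specialize,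
    map_specialize]
  simp only [hvar]
  congr 2
  funext a
  have hβ' := map_flatten (β : T →+* T) d (varIn K n T) (invVar K n T) (coeffIn K n T) a
  simp only [RingHom.coe_coe, hvar, hcoeff, hinv] at hβ'
  rw [hβ', ← hmk, ← hmk, map_flatten]
  simp only [map_twist, map_ratio]
  refine congrFun (flatten_twist_ratio ?_ ?_) a
  · rw [← map_mul, varIn_zero_mul_invVar, map_one]
  · have h1 : Ideal.Quotient.mk J (algebraMap (GenericRing K n) T (genericPoly K n d)) = 0 :=
      Ideal.Quotient.eq_zero_iff_mem.2 (Ideal.mem_span_singleton_self _)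
    rw [algebraMap_eq_specialize (T := T), hmk, map_specialize, specialize_genericPoly] at h1
    exact h1

theorem IsFlexPolynomial.comap_eliminateTop (hn : 2 ≤ n) {d : ℕ} [IsDomain T] [CharZero K]
    [IsAlgClosed K] (hd : n ≤ d)
    {Φ : GenericRing K n}
    (h : IsFlexPolynomial d Φ) :
    Ideal.comap (eliminateTop K T d) (Ideal.span {eliminateTop K T d Φ}) =
      Ideal.span {genericPoly K n d, Φ} := by
  refine le_antisymm (fun g hg => ?_) ?_
  · obtain ⟨β, hβ⟩ := exists_algHom_eliminateTop (K := K) (n := n) (T := T) d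
    set I : Ideal (GenericRing K n) :=
      Ideal.span {genericPoly K n d, Φ} with hI
    have hle : Ideal.span {algebraMap (GenericRing K n) T (genericPoly K n d)} ≤
        I.map (algebraMap (GenericRing K n) T) := by
      rw [Ideal.span_le, Set.singleton_subset_iff]
      exact Ideal.mem_map_of_mem _ (Ideal.subset_span (by simp))
    obtain ⟨u, hu⟩ := Ideal.mem_span_singleton'.1 (Ideal.mem_comap.1 hg)
    have hΦ : β (eliminateTop K T d Φ) ∈ I.map (algebraMap (GenericRing K n) T) := by
      rw [← sub_add_cancel (β (eliminateTop K T d Φ)) (algebraMap (GenericRing K n) T Φ)]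
      exact add_mem (hle (hβ Φ)) (Ideal.mem_map_of_mem _ (Ideal.subset_span (by simp)))
    have hmem : algebraMap (GenericRing K n) T g ∈ I.map (algebraMap (GenericRing K n) T) := by
      rw [← sub_sub_cancel (β (eliminateTop K T d g)) (algebraMap (GenericRing K n) T g)]
      refine sub_mem ?_ (hle (hβ g))
      rw [← hu, map_mul]
      exact Ideal.mul_mem_left _ _ hΦ
    obtain ⟨_, ⟨N, rfl⟩, hN⟩ := (IsLocalization.algebraMap_mem_map_algebraMap_iff
      (Submonoid.powers (MvPolynomial.X 0)) T I g).1 hmem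
    change MvPolynomial.X 0 ^ N * g ∈ I at hN
    clear hmem hu hg
    induction N with
    | zero => simpa using hN
    | succ N ih =>
      rw [pow_succ', mul_assoc] at hN
      exact ih (h.mem_span_of_X_zero_mul_mem hn hd hN)
  · rw [Ideal.span_le]
    rintro f (rfl | rfl)
    · simp [eliminateTop_genericPoly]
    · exact Ideal.mem_comap.2 (Ideal.mem_span_singleton_self _)

theorem flatten_single_mul {R : Type} [CommRing R] (d : ℕ) (r : R) (c : (Fin (n + 1) →₀ ℕ) → R) :
    flatten d (Pi.single 0 1) 1 (fun a => r * c a) =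
      fun a => r * flatten d (Pi.single 0 1) 1 c a := by
  have h : -ratio (Pi.single 0 1 : Fin (n + 1) → R) 1 = 0 := by
    funext i
    by_cases hi : i = 0
    · simp [ratio, hi]
    · simp [ratio, hi]
  simp only [flatten, h, twist_zero, mul_ite, mul_zero]

theorem eval_eval_single_one (c : (Fin (n + 1) →₀ ℕ) → K) (j : Fin (n + 1))
    (f : GenericRing K n) :
    MvPolynomial.eval c (MvPolynomial.eval (Pi.single j 1) f) =
      specialize c (Pi.single j 1) f := by
  induction f using MvPolynomial.induction_on with
  | C p => rw [specialize_C, MvPolynomial.eval_C, MvPolynomial.aeval_eq_eval]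
  | add p q hp hq => rw [map_add, map_add, map_add, hp, hq]
  | mul_X p i hp =>
    rw [map_mul, map_mul, map_mul, hp, specialize_X, MvPolynomial.eval_X]
    by_cases hi : i = j
    · simp [hi]
    · simp [hi]

/-- Up to a unit, the universal flex polynomial becomes a prime polynomial in the coefficients once
the coefficient of `x₀ ^ d` is eliminated. -/
theorem IsFlexPolynomial.exists_eliminateTop_mul_eq (hn : 1 ≤ n) {d : ℕ} [IsDomain T] [CharZero K]
    [IsAlgClosed K] (hd : n ≤ d) {Φ : GenericRing K n} (h : IsFlexPolynomial d Φ)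
    (hΦ : ∀ m, (Φ.coeff m).IsHomogeneous (∑ k ∈ Finset.Icc 1 n, n.factorial / k)) :
    ∃ (p : MvPolynomial (Fin (n + 1) →₀ ℕ) K) (N e : ℕ), Irreducible p ∧ p.eval 0 = 0 ∧
      eliminateTop K T d Φ * varIn K n T 0 ^ N =
        algebraMap (GenericRing K n) T (MvPolynomial.C p) * varIn K n T 0 ^ e := by
  obtain ⟨⟨Ψ, _, N, rfl⟩, hΨ⟩ := IsLocalization.surj
    (Submonoid.powers (MvPolynomial.X 0 : GenericRing K n)) (eliminateTop K T d Φ)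
  change eliminateTop K T d Φ * algebraMap (GenericRing K n) T (MvPolynomial.X 0 ^ N) = _ at hΨ
  have hpt : ∀ (c : (Fin (n + 1) →₀ ℕ) → K) (x : Fin (n + 1) → K), x 0 ≠ 0 →
      specialize c x Ψ = specialize (flatten d x (x 0)⁻¹ c) x Φ * x 0 ^ N := by
    intro c x hx
    obtain ⟨π, hπ⟩ := exists_algHom_extending (K := K) (T := T) c x hx.isUnit
    have hvar : ∀ i, π (varIn K n T i) = x i := fun i => by
      rw [varIn, hπ, specialize_X]
    have hcoeff : ∀ a, π (coeffIn K n T a) = c a := fun a => by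
      rw [coeffIn, hπ, specialize_C, MvPolynomial.aeval_X]
    have hinv : π (invVar K n T) = (x 0)⁻¹ := by
      have h1 := congrArg π (varIn_zero_mul_invVar (K := K) (n := n) (T := T))
      rw [map_mul, hvar, map_one] at h1
      exact eq_inv_of_mul_eq_one_right h1
    have h1 := congrArg π hΨ
    rw [map_mul, hπ, hπ, map_pow, specialize_X, eliminateTop, map_specialize] at h1
    rw [← h1]
    congr 2
    simp only [hvar]
    congr 1
    funext a
    have h2 := map_flatten (π : T →+* K) d (varIn K n T) (invVar K n T) (coeffIn K n T) a
    simp only [RingHom.coe_coe, hvar, hcoeff, hinv] at h2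
    exact h2
  have hzero : ∀ (c : (Fin (n + 1) →₀ ℕ) → K) (x : Fin (n + 1) → K), x 0 ≠ 0 →
      (specialize c x Ψ = 0 ↔ Degenerate d c) := fun c x hx => by
    rw [hpt c x hx, mul_eq_zero, or_iff_left (pow_ne_zero _ hx),
      h.specialize_flatten_eq_zero_iff hx]
  have he : (Pi.single 0 1 : Fin (n + 1) → K) 0 ≠ 0 := by simp
  obtain ⟨c₀, hc₀⟩ := exists_not_degenerate (K := K) hn hd
  obtain ⟨e, p, rfl⟩ := MvPolynomial.eq_monomial_single_of_generic 0 Ψ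
    (MvPolynomial.eval (Pi.single 0 1) Ψ)
    (fun h0 => hc₀ ((hzero c₀ _ he).1 (by rw [← eval_eval_single_one, h0, map_zero])))
    (fun c x hc hx => by
      rw [eval_eval_single_one, Ne, hzero c _ he] at hc
      intro h0
      refine hc ((hzero c x hx).1 ?_)
      rw [specialize_eq_eval]
      exact h0)
  have hp : ∀ c : (Fin (n + 1) →₀ ℕ) → K, MvPolynomial.eval c p =
      specialize c (Pi.single 0 1) (MvPolynomial.monomial (Finsupp.single 0 e) p) := fun c => by
    rw [specialize_monomial]
    simp [MvPolynomial.aeval_eq_eval]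
  have hdeg : ∀ c, MvPolynomial.eval c p = 0 ↔ Degenerate d c := fun c => by
    rw [hp, hzero c _ he]
  refine ⟨p, N, e, irreducible_of_eval_eq_zero_iff_degenerate hn hd hdeg fun r c => ?_,
    (hdeg 0).2 ?_, ?_⟩
  · rw [hp, hp, hpt _ _ he, hpt _ _ he]
    simp only [Pi.single_eq_same, inv_one]
    rw [flatten_single_mul, specialize_mul_of_isHomogeneous hΦ, mul_assoc]
  · exact ⟨1, fun h0 => one_ne_zero (congrFun h0 ⟨0, hn⟩), fun k _ _ => by simp [tailForm]⟩
  · rw [varIn, ← map_pow, ← map_pow, hΨ, ← map_mul]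
    congr 1
    rw [MvPolynomial.C_mul_X_pow_eq_monomial]

theorem IsFlexPolynomial.isPrime_span_eliminateTop (hn : 1 ≤ n) {d : ℕ} [IsDomain T] [CharZero K]
    [IsAlgClosed K] (hd : n ≤ d) {Φ : GenericRing K n} (h : IsFlexPolynomial d Φ)
    (hΦ : ∀ m, (Φ.coeff m).IsHomogeneous (∑ k ∈ Finset.Icc 1 n, n.factorial / k)) :
    (Ideal.span {eliminateTop K T d Φ}).IsPrime := by
  obtain ⟨p, N, e, hirr, hp0, hp⟩ := h.exists_eliminateTop_mul_eq (T := T) hn hd hΦ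
  have hu : IsUnit (varIn K n T 0) := IsUnit.of_mul_eq_one _ varIn_zero_mul_invVar
  have hspan : Ideal.span {eliminateTop K T d Φ} =
      (Ideal.span {(MvPolynomial.C p : GenericRing K n)}).map (algebraMap (GenericRing K n) T) := by
    rw [Ideal.map_span, Set.image_singleton, ← Ideal.span_singleton_mul_right_unit (hu.pow N), hp,
      Ideal.span_singleton_mul_right_unit (hu.pow e)]
  have hprime : Prime (MvPolynomial.C p : GenericRing K n) :=
    (MvPolynomial.prime_C_iff _).2 (UniqueFactorizationMonoid.irreducible_iff_prime.1 hirr)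
  rw [hspan]
  refine IsLocalization.isPrime_of_isPrime_disjoint
    (Submonoid.powers (MvPolynomial.X 0 : GenericRing K n)) T _
    ((Ideal.span_singleton_prime hprime.ne_zero).2 hprime) ?_
  rw [Set.disjoint_left]
  rintro _ ⟨m, rfl⟩ hm
  obtain ⟨b, hb⟩ := Ideal.mem_span_singleton'.1 hm
  have h1 := congrArg (specialize (K := K) (0 : (Fin (n + 1) →₀ ℕ) → K) (Pi.single 0 1)) hb
  rw [map_mul, specialize_C, MvPolynomial.aeval_eq_eval, hp0, mul_zero] at h1
  simp [specialize_X] at h1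

theorem IsFlexPolynomial.isPrime_span (hn : 2 ≤ n) {d : ℕ} [CharZero K] [IsAlgClosed K]
    (hd : n ≤ d) {Φ : GenericRing K n} (h : IsFlexPolynomial d Φ)
    (hΦ : ∀ m, (Φ.coeff m).IsHomogeneous (∑ k ∈ Finset.Icc 1 n, n.factorial / k)) :
    (Ideal.span {genericPoly K n d, Φ}).IsPrime := by
  let T := Localization.Away (MvPolynomial.X 0 : GenericRing K n)
  have hT : IsDomain T := IsLocalization.isDomain_localization
    (powers_le_nonZeroDivisors_of_noZeroDivisors (MvPolynomial.X_ne_zero 0))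
  rw [← h.comap_eliminateTop (T := T) hn hd]
  have := h.isPrime_span_eliminateTop (T := T) (by omega) hd hΦ
  exact Ideal.comap_isPrime _ _

end Prime

theorem universal_flex_ideal_prime
    (K : Type) [Field K] [IsAlgClosed K] [CharZero K] (n d : ℕ) (hn : 1 ≤ n)
    (hd : n ≤ d)
    -- the abstract resultant for degrees (1, 2, …, n, 1) in y₀,…,yₙ:
    (Res : ∀ (R : Type) [CommRing R] [Algebra K R],
      (Fin (n + 1) → MvPolynomial (Fin (n + 1)) R) → R)
    (hnat : ∀ (R : Type) [CommRing R] [Algebra K R] (S : Type) [CommRing S] [Algebra K S]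
      (φ : R →ₐ[K] S) (sys : Fin (n + 1) → MvPolynomial (Fin (n + 1)) R),
      Res S (fun i => MvPolynomial.map (φ : R →+* S) (sys i)) = φ (Res R sys))
    (hvan : ∀ sys : Fin (n + 1) → MvPolynomial (Fin (n + 1)) K,
      (∀ i, (sys i).IsHomogeneous (Fin.lastCases 1 (fun j : Fin n => (j : ℕ) + 1) i)) →
      (Res K sys = 0 ↔ ∃ z : Fin (n + 1) → K, z ≠ 0 ∧ ∀ i, MvPolynomial.eval z (sys i) = 0))
    -- the universal flex polynomial Φ_d:
    (Φ : MvPolynomial (Fin (n + 1)) (MvPolynomial (Fin (n + 1) →₀ ℕ) K))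
    (hΦx : Φ.IsHomogeneous (d * (∑ k ∈ Finset.Icc 1 n, n.factorial / k) - (n + 1).factorial))
    (hΦc : ∀ m : Fin (n + 1) →₀ ℕ,
      (MvPolynomial.coeff m Φ).IsHomogeneous (∑ k ∈ Finset.Icc 1 n, n.factorial / k))
    (hcong : ∀ ℓ : MvPolynomial (Fin (n + 1)) K, ℓ.IsHomogeneous 1 →
      genericPoly K n d ∣
        (Res (MvPolynomial (Fin (n + 1)) (MvPolynomial (Fin (n + 1) →₀ ℕ) K))
            (Fin.lastCases
              (MvPolynomial.map
                (algebraMap K (MvPolynomial (Fin (n + 1)) (MvPolynomial (Fin (n + 1) →₀ ℕ) K))) ℓ)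
              (fun j : Fin n => dirCoeffY (genericPoly K n d) ((j : ℕ) + 1))) -
          (MvPolynomial.map
            (algebraMap K (MvPolynomial (Fin (n + 1) →₀ ℕ) K)) ℓ) ^ n.factorial * Φ)) :
    (Ideal.span {genericPoly K n d, Φ} :
      Ideal (MvPolynomial (Fin (n + 1)) (MvPolynomial (Fin (n + 1) →₀ ℕ) K))).IsPrime := by
  have h : IsFlexPolynomial d Φ := by
    refine isFlexPolynomial_of_resultant hvan fun c x ℓ hℓ hx => ?_
    obtain ⟨b, hb⟩ := exists_resultant_polarForm_eq hnat (hcong ℓ hℓ) c x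
    rwa [hx, zero_mul, add_zero, Algebra.algebraMap_self, MvPolynomial.map_id,
      MvPolynomial.aeval_eq_eval] at hb
  obtain rfl | hn' := hn.eq_or_lt
  · refine (false_of_binary_resultant hd hnat h (by simpa using hΦc) fun ℓ c x hℓ =>
      exists_resultant_polarForm_eq hnat (hcong ℓ hℓ) c x).elim
  · exact h.isPrime_span hn' hd hΦc
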